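/- Let d ≥ 2 and let v be a bounded solution of the hodograph PDE on H₁ = {y : y_d ≥ 0, |y| ≥ 1} with |∇v(y)| ≤ 1/2 for all y ∈ H₁. Then the limit v_∞ := lim_{|y|→∞, y∈H₁} v(y) exists, and for every y ∈ H₁ one has min{ min_{∂B₁⁺} v, v_∞ } ≤ v(y) ≤ max{ max_{∂B₁⁺} v, v_∞ }. -/

import Mathlib

open Real Set Filter MeasureTheory

noncomputable section

/-- The last index of `Fin d`. -/
def lastIdx (d : ℕ) (hd : 0 < d) : Fin d := ⟨d - 1, by omega⟩

/-- The `i`-th partial derivative of `v` at `y`. -/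
def gradC (d : ℕ) (v : EuclideanSpace ℝ (Fin d) → ℝ)
    (y : EuclideanSpace ℝ (Fin d)) (i : Fin d) : ℝ :=
  fderiv ℝ v y (EuclideanSpace.single i 1)

/-- The `(i,j)` entry of the Hessian of `v` at `y`. -/
def hessC (d : ℕ) (v : EuclideanSpace ℝ (Fin d) → ℝ)
    (y : EuclideanSpace ℝ (Fin d)) (i j : Fin d) : ℝ :=
  fderiv ℝ (fun z => fderiv ℝ v z (EuclideanSpace.single i 1)) y (EuclideanSpace.single j 1)

/-- The squared euclidean norm of the tangential part `p'` of `p`. -/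
def tangSq (d : ℕ) (hd : 0 < d) (p : Fin d → ℝ) : ℝ :=
  ∑ m : Fin d, if m = lastIdx d hd then 0 else (p m) ^ 2

/-- The coefficient matrix `A(p)` of the hodograph PDE. -/
def hodA (d : ℕ) (hd : 0 < d) (p : Fin d → ℝ) (i j : Fin d) : ℝ :=
  if i = lastIdx d hd then
    (if j = lastIdx d hd then (1 + tangSq d hd p) / (1 + p (lastIdx d hd)) ^ 2
     else p j / (1 + p (lastIdx d hd)))
  else
    (if j = lastIdx d hd then p i / (1 + p (lastIdx d hd))
     else if i = j then 1 else 0)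

/-- The boundary nonlinearity `N(p') = √(1 + |p'|²) - 1`. -/
def hodN (d : ℕ) (hd : 0 < d) (p : Fin d → ℝ) : ℝ :=
  Real.sqrt (1 + tangSq d hd p) - 1

/-- The quantity `tr(A(∇v(y)) D²v(y))`. -/
def hodOp (d : ℕ) (hd : 0 < d) (v : EuclideanSpace ℝ (Fin d) → ℝ)
    (y : EuclideanSpace ℝ (Fin d)) : ℝ :=
  ∑ i : Fin d, ∑ j : Fin d, hodA d hd (fun m => gradC d v y m) i j * hessC d v y i j

/-- `v` is `C^∞` on an open neighborhood of `U`. -/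
def SmoothNear (d : ℕ) (v : EuclideanSpace ℝ (Fin d) → ℝ)
    (U : Set (EuclideanSpace ℝ (Fin d))) : Prop :=
  ∃ W : Set (EuclideanSpace ℝ (Fin d)), IsOpen W ∧ U ⊆ W ∧ ContDiffOn ℝ (⊤ : ℕ∞) v W

/-- `v` is a (classical) solution of the hodograph PDE on `U`. -/
def IsHodSol (d : ℕ) (hd : 0 < d) (v : EuclideanSpace ℝ (Fin d) → ℝ)
    (U : Set (EuclideanSpace ℝ (Fin d))) : Prop :=
  SmoothNear d v U ∧
  (∀ y ∈ U, 0 < y (lastIdx d hd) → hodOp d hd v y = 0) ∧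
  (∀ y ∈ U, y (lastIdx d hd) = 0 →
    gradC d v y (lastIdx d hd) = hodN d hd (fun m => gradC d v y m))

/-- `v` is a subsolution of the hodograph PDE on `U`. -/
def IsHodSubsol (d : ℕ) (hd : 0 < d) (v : EuclideanSpace ℝ (Fin d) → ℝ)
    (U : Set (EuclideanSpace ℝ (Fin d))) : Prop :=
  SmoothNear d v U ∧
  (∀ y ∈ U, 0 < y (lastIdx d hd) → 0 ≤ hodOp d hd v y) ∧
  (∀ y ∈ U, y (lastIdx d hd) = 0 →
    hodN d hd (fun m => gradC d v y m) ≤ gradC d v y (lastIdx d hd))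

/-- `v` is a supersolution of the hodograph PDE on `U`. -/
def IsHodSupersol (d : ℕ) (hd : 0 < d) (v : EuclideanSpace ℝ (Fin d) → ℝ)
    (U : Set (EuclideanSpace ℝ (Fin d))) : Prop :=
  SmoothNear d v U ∧
  (∀ y ∈ U, 0 < y (lastIdx d hd) → hodOp d hd v y ≤ 0) ∧
  (∀ y ∈ U, y (lastIdx d hd) = 0 →
    gradC d v y (lastIdx d hd) ≤ hodN d hd (fun m => gradC d v y m))

/-- The exterior half-space domain `H₁ = {y : y_d ≥ 0, |y| ≥ 1}`. -/
def extDom (d : ℕ) (hd : 0 < d) : Set (EuclideanSpace ℝ (Fin d)) :=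
  {y | 0 ≤ y (lastIdx d hd) ∧ 1 ≤ ‖y‖}

/-- The half annulus `A_r = {y : 1 ≤ |y| ≤ r, y_d ≥ 0}`. -/
def halfAnn (d : ℕ) (hd : 0 < d) (r : ℝ) : Set (EuclideanSpace ℝ (Fin d)) :=
  {y | 0 ≤ y (lastIdx d hd) ∧ 1 ≤ ‖y‖ ∧ ‖y‖ ≤ r}

/-- The upper half sphere `∂B_ρ⁺ = {y : y_d ≥ 0, |y| = ρ}`. -/
def upSphere (d : ℕ) (hd : 0 < d) (ρ : ℝ) : Set (EuclideanSpace ℝ (Fin d)) :=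
  {y | 0 ≤ y (lastIdx d hd) ∧ ‖y‖ = ρ}

/-- The filter of `|y| → ∞` within `H₁`. -/
def farFilter (d : ℕ) (hd : 0 < d) : Filter (EuclideanSpace ℝ (Fin d)) :=
  (Filter.comap (fun y : EuclideanSpace ℝ (Fin d) => ‖y‖) Filter.atTop) ⊓
    Filter.principal (extDom d hd)

open scoped Topology ContDiff

theorem fderiv_along_line {E : Type*} [NormedAddCommGroup E] [NormedSpace ℝ E] {f : E → ℝ} {x X : E}
    {t : ℝ} (hf : DifferentiableAt ℝ f (x + t • X)) :
    HasDerivAt (fun s : ℝ => f (x + s • X)) (fderiv ℝ f (x + t • X) X) t := by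
  have h1 : HasDerivAt (fun s : ℝ => x + s • X) X t := by
    simpa using ((hasDerivAt_id t).smul_const X).const_add x
  exact hf.hasFDerivAt.comp_hasDerivAt t h1

theorem hasFDerivAt_fderiv_apply {E : Type*} [NormedAddCommGroup E] [NormedSpace ℝ E] {f : E → ℝ}
    {x : E} (hf : DifferentiableAt ℝ (fderiv ℝ f) x) (X : E) :
    HasFDerivAt (fun y => fderiv ℝ f y X) ((fderiv ℝ (fderiv ℝ f) x).flip X) x := by
  have := (ContinuousLinearMap.apply ℝ ℝ X).hasFDerivAt.comp x hf.hasFDerivAt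
  exact this.congr_fderiv (by ext; rfl)

theorem hessian_nonpos_of_isLocalMax {E : Type*} [NormedAddCommGroup E] [NormedSpace ℝ E] {f : E → ℝ}
    {x : E} (hf : ContDiffAt ℝ 2 f x) (h : IsLocalMax f x) (X : E) :
    fderiv ℝ (fderiv ℝ f) x X X ≤ 0 := by
  by_contra! hpos
  have hline : Tendsto (fun s : ℝ => x + s • X) (𝓝 0) (𝓝 x) := by
    have : Continuous (fun s : ℝ => x + s • X) := by fun_prop
    simpa using this.tendsto 0
  have hd : ∀ᶠ y in 𝓝 x, DifferentiableAt ℝ f y := by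
    filter_upwards [hf.eventually (by simp)] with y hy
    exact hy.differentiableAt (by simp)
  have hderiv : deriv (fun s : ℝ => f (x + s • X)) =ᶠ[𝓝 0] fun s => fderiv ℝ f (x + s • X) X := by
    filter_upwards [hline.eventually hd] with s hs
    exact (fderiv_along_line hs).deriv
  have hf' : DifferentiableAt ℝ (fderiv ℝ f) x :=
    (hf.fderiv_right (m := 1) (by norm_num)).differentiableAt (by simp)
  have h2 : HasDerivAt (fun s : ℝ => fderiv ℝ f (x + s • X) X)
      (fderiv ℝ (fderiv ℝ f) x X X) 0 := by
    have h3 := hasFDerivAt_fderiv_apply hf' X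
    have h4 : DifferentiableAt ℝ (fun y => fderiv ℝ f y X) (x + (0 : ℝ) • X) := by
      simpa using h3.differentiableAt
    have h5 := fderiv_along_line h4
    rw [zero_smul, add_zero, h3.fderiv] at h5
    simpa using h5
  have hdd : deriv (deriv (fun s : ℝ => f (x + s • X))) 0 = fderiv ℝ (fderiv ℝ f) x X X := by
    rw [hderiv.deriv_eq, h2.deriv]
  have hd0 : deriv (fun s : ℝ => f (x + s • X)) 0 = 0 := by
    rw [hderiv.eq_of_nhds]
    simp [h.fderiv_eq_zero]
  have hcont : ContinuousAt (fun s : ℝ => f (x + s • X)) 0 := by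
    refine (fderiv_along_line ?_).continuousAt
    simpa using hf.differentiableAt (by simp)
  have hmin := isLocalMin_of_deriv_deriv_pos (by rw [hdd]; exact hpos) hd0 hcont
  have hmax : ∀ᶠ s : ℝ in 𝓝 0, f (x + s • X) ≤ f x := hline.eventually h
  have hconst : (fun s : ℝ => f (x + s • X)) =ᶠ[𝓝 0] fun _ => f x := by
    filter_upwards [hmin, hmax] with s h1 h2
    simp only [zero_smul, add_zero] at h1
    exact le_antisymm h2 h1
  have : deriv (deriv (fun s : ℝ => f (x + s • X))) 0 = 0 := by
    rw [hconst.deriv.deriv_eq]; simp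
  linarith

/-- At a maximum point over a compact piece of a half-space, either the point lies in the exceptional
set `Γ`, or the first and second order interior conditions hold, or the one-sided first order
condition on the flat boundary holds. -/
theorem exists_isMaxOn_halfSpace {d : ℕ} (l : Fin d) {K Γ : Set (EuclideanSpace ℝ (Fin d))}
    (hK : IsCompact K) (hne : K.Nonempty) (hpos : ∀ x ∈ K, 0 ≤ x l)
    (hnhd : ∀ x ∈ K, x ∉ Γ → ∀ᶠ z in 𝓝 x, 0 ≤ z l → z ∈ K)
    {φ : EuclideanSpace ℝ (Fin d) → ℝ} (hφ : ∀ x ∈ K, ContDiffAt ℝ 2 φ x) :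
    ∃ x ∈ K, (∀ y ∈ K, φ y ≤ φ x) ∧
      (x ∈ Γ ∨ (x ∉ Γ ∧ 0 < x l ∧ fderiv ℝ φ x = 0 ∧ ∀ X, fderiv ℝ (fderiv ℝ φ) x X X ≤ 0) ∨
        (x ∉ Γ ∧ x l = 0 ∧ ∀ X : EuclideanSpace ℝ (Fin d), 0 ≤ X l → fderiv ℝ φ x X ≤ 0)) := by
  obtain ⟨x, hx, hmax⟩ := hK.exists_isMaxOn hne
    (fun x hx => (hφ x hx).continuousAt.continuousWithinAt)
  refine ⟨x, hx, hmax, ?_⟩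
  by_cases hG : x ∈ Γ
  · exact Or.inl hG
  refine Or.inr ?_
  have hn := hnhd x hx hG
  rcases (hpos x hx).lt_or_eq with h0 | h0
  · left
    have hcl : ContinuousAt (fun z : EuclideanSpace ℝ (Fin d) => z l) x := by fun_prop
    have hloc : IsLocalMax φ x := by
      filter_upwards [hn, hcl.eventually (lt_mem_nhds h0)] with z hz hz0
      exact hmax (hz (le_of_lt hz0))
    exact ⟨hG, h0, hloc.fderiv_eq_zero, hessian_nonpos_of_isLocalMax (hφ x hx) hloc⟩
  · right
    refine ⟨hG, h0.symm, fun X hX => ?_⟩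
    have hloc : IsLocalMaxOn φ {z | 0 ≤ z l} x := by
      rw [IsLocalMaxOn, IsMaxFilter, eventually_nhdsWithin_iff]
      filter_upwards [hn] with z hz hz0
      exact hmax (hz hz0)
    refine hloc.hasFDerivWithinAt_nonpos
      (((hφ x hx).differentiableAt (by simp)).hasFDerivAt.hasFDerivWithinAt)
      (mem_posTangentConeAt_of_segment_subset ?_)
    rintro z ⟨a, b, ha, hb, hab, rfl⟩
    have : 0 ≤ a * x l + b * (x l + X l) := by
      rw [← h0]; positivity
    simpa [mul_add] using this

section SecondOrder

variable {E : Type*} [NormedAddCommGroup E] [NormedSpace ℝ E] {f g : E → ℝ} {x : E}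

theorem ContDiffAt.differentiableAt_fderiv_real (hf : ContDiffAt ℝ 2 f x) :
    DifferentiableAt ℝ (fderiv ℝ f) x :=
  (hf.fderiv_right (m := 1) (by norm_num)).differentiableAt (by simp)

theorem ContDiffAt.eventually_differentiableAt_real (hf : ContDiffAt ℝ 2 f x) :
    ∀ᶠ y in 𝓝 x, DifferentiableAt ℝ f y := by
  filter_upwards [hf.eventually (by simp)] with y hy
  exact hy.differentiableAt (by simp)

theorem hessian_add (hf : ContDiffAt ℝ 2 f x) (hg : ContDiffAt ℝ 2 g x) :
    fderiv ℝ (fderiv ℝ (fun y => f y + g y)) x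
      = fderiv ℝ (fderiv ℝ f) x + fderiv ℝ (fderiv ℝ g) x := by
  have : fderiv ℝ (fun y => f y + g y) =ᶠ[𝓝 x] fun y => fderiv ℝ f y + fderiv ℝ g y := by
    filter_upwards [hf.eventually_differentiableAt_real, hg.eventually_differentiableAt_real]
      with y h1 h2
    exact fderiv_fun_add h1 h2
  rw [this.fderiv_eq]
  exact fderiv_fun_add hf.differentiableAt_fderiv_real hg.differentiableAt_fderiv_real

theorem hessian_const_mul (c : ℝ) (hf : ContDiffAt ℝ 2 f x) :
    fderiv ℝ (fderiv ℝ (fun y => c * f y)) x = c • fderiv ℝ (fderiv ℝ f) x := by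
  have : fderiv ℝ (fun y => c * f y) =ᶠ[𝓝 x] fun y => c • fderiv ℝ f y := by
    filter_upwards [hf.eventually_differentiableAt_real] with y h1
    exact fderiv_const_mul h1 c
  rw [this.fderiv_eq]
  exact fderiv_fun_const_smul hf.differentiableAt_fderiv_real c

theorem hessian_sub_const (c : ℝ) :
    fderiv ℝ (fderiv ℝ (fun y => f y - c)) x = fderiv ℝ (fderiv ℝ f) x := by
  have : fderiv ℝ (fun y => f y - c) = fderiv ℝ f := by
    ext1 y; exact fderiv_sub_const c
  rw [this]

theorem hessian_mul (hf : ContDiffAt ℝ 2 f x) (hg : ContDiffAt ℝ 2 g x) (X Y : E) :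
    fderiv ℝ (fderiv ℝ (fun y => f y * g y)) x X Y
      = f x * fderiv ℝ (fderiv ℝ g) x X Y + g x * fderiv ℝ (fderiv ℝ f) x X Y
        + fderiv ℝ f x X * fderiv ℝ g x Y + fderiv ℝ g x X * fderiv ℝ f x Y := by
  have : fderiv ℝ (fun y => f y * g y) =ᶠ[𝓝 x] fun y => f y • fderiv ℝ g y + g y • fderiv ℝ f y := by
    filter_upwards [hf.eventually_differentiableAt_real, hg.eventually_differentiableAt_real]
      with y h1 h2
    exact fderiv_fun_mul h1 h2
  have hf1 := hf.differentiableAt (by simp)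
  have hg1 := hg.differentiableAt (by simp)
  have hf2 := hf.differentiableAt_fderiv_real
  have hg2 := hg.differentiableAt_fderiv_real
  rw [this.fderiv_eq, fderiv_fun_add (hf1.fun_smul hg2) (hg1.fun_smul hf2), fderiv_fun_smul hf1 hg2,
    fderiv_fun_smul hg1 hf2]
  simp
  ring

theorem hessian_exp (hf : ContDiffAt ℝ 2 f x) (X Y : E) :
    fderiv ℝ (fderiv ℝ (fun y => Real.exp (f y))) x X Y
      = Real.exp (f x) * (fderiv ℝ (fderiv ℝ f) x X Y + fderiv ℝ f x X * fderiv ℝ f x Y) := by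
  have : fderiv ℝ (fun y => Real.exp (f y)) =ᶠ[𝓝 x] fun y => Real.exp (f y) • fderiv ℝ f y := by
    filter_upwards [hf.eventually_differentiableAt_real] with y h1
    exact fderiv_exp h1
  have hf1 := hf.differentiableAt (by simp)
  have hf2 := hf.differentiableAt_fderiv_real
  rw [this.fderiv_eq, fderiv_fun_smul hf1.exp hf2, fderiv_exp hf1]
  simp
  ring

end SecondOrder

section Quadratic

variable {E : Type*} [NormedAddCommGroup E] [InnerProductSpace ℝ E]

theorem fderiv_norm_sub_sq (c y X : E) :
    fderiv ℝ (fun z => ‖z - c‖ ^ 2) y X = 2 * inner ℝ (y - c) X := by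
  have h := ((hasFDerivAt_id y).sub_const c).norm_sq
  have h2 : HasFDerivAt (fun z => ‖z - c‖ ^ 2) _ y := h
  rw [h2.fderiv]
  simp [inner_sub_left]

theorem hessian_norm_sub_sq (c y X Y : E) :
    fderiv ℝ (fderiv ℝ (fun z => ‖z - c‖ ^ 2)) y X Y = 2 * inner ℝ X Y := by
  have h : fderiv ℝ (fun z : E => ‖z - c‖ ^ 2) = fun z => (2 : ℝ) • innerSL ℝ (z - c) := by
    ext z W
    rw [fderiv_norm_sub_sq]; simp [inner_sub_left]
  rw [h]
  have h3 : HasFDerivAt (fun z : E => (2 : ℝ) • innerSL ℝ (z - c)) ((2 : ℝ) • innerSL ℝ) y := by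
    have := ((innerSL ℝ (E := E)).hasFDerivAt.comp y ((hasFDerivAt_id y).sub_const c)).const_smul
      (2 : ℝ)
    exact this.congr_fderiv (by ext; simp)
  rw [h3.fderiv]
  rfl

theorem contDiffAt_norm_sub_sq (c y : E) (n : WithTop ℕ∞) :
    ContDiffAt ℝ n (fun z => ‖z - c‖ ^ 2) y :=
  ((contDiffAt_id.sub contDiffAt_const).norm_sq ℝ)

end Quadratic

/-- The `i`-th standard basis vector. -/
abbrev stdE {d : ℕ} (i : Fin d) : EuclideanSpace ℝ (Fin d) := EuclideanSpace.single i 1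

/-- The linear part of the frame diagonalising the coefficient matrix of the hodograph PDE. -/
def frameLin {d : ℕ} (l m : Fin d) :
    (EuclideanSpace ℝ (Fin d) →L[ℝ] ℝ) →L[ℝ] EuclideanSpace ℝ (Fin d) :=
  if m = l then 0 else
    (ContinuousLinearMap.apply ℝ ℝ (stdE l)).smulRight (stdE m) +
      (ContinuousLinearMap.apply ℝ ℝ (stdE m)).smulRight (stdE l)

/-- The frame `X_m`, so that `(1 + p_d)² A(p) = ∑ X_m ⊗ X_m`. -/
def frame {d : ℕ} (l m : Fin d) (α : EuclideanSpace ℝ (Fin d) →L[ℝ] ℝ) :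
    EuclideanSpace ℝ (Fin d) :=
  stdE m + frameLin l m α

/-- The trace of a bilinear form against the frame. -/
def hodTr {d : ℕ} (l : Fin d) (α : EuclideanSpace ℝ (Fin d) →L[ℝ] ℝ)
    (H : EuclideanSpace ℝ (Fin d) →L[ℝ] EuclideanSpace ℝ (Fin d) →L[ℝ] ℝ) : ℝ :=
  ∑ m, H (frame l m α) (frame l m α)

section Frame

variable {d : ℕ} {l m : Fin d} {α : EuclideanSpace ℝ (Fin d) →L[ℝ] ℝ}

theorem frameLin_self : frameLin l l α = 0 := by simp [frameLin]

theorem frameLin_of_ne (h : m ≠ l) :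
    frameLin l m α = α (stdE l) • stdE m + α (stdE m) • stdE l := by
  simp [frameLin, h]

theorem frame_self : frame l l α = stdE l := by simp [frame, frameLin_self]

theorem frame_of_ne (h : m ≠ l) :
    frame l m α = (1 + α (stdE l)) • stdE m + α (stdE m) • stdE l := by
  rw [frame, frameLin_of_ne h, add_smul, one_smul, add_assoc]

theorem tangSq_eq (hd : 0 < d) (p : Fin d → ℝ) :
    tangSq d hd p = ∑ m ∈ Finset.univ.erase (lastIdx d hd), p m ^ 2 := by
  rw [tangSq, ← Finset.add_sum_erase _ _ (Finset.mem_univ (lastIdx d hd)), if_pos rfl, zero_add]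
  exact Finset.sum_congr rfl fun m hm => if_neg (Finset.ne_of_mem_erase hm)

theorem hodTr_eq (hd : 0 < d) (H : EuclideanSpace ℝ (Fin d) →L[ℝ] EuclideanSpace ℝ (Fin d) →L[ℝ] ℝ)
    (hα : 1 + α (stdE (lastIdx d hd)) ≠ 0) :
    hodTr (lastIdx d hd) α H = (1 + α (stdE (lastIdx d hd))) ^ 2 *
      ∑ i, ∑ j, hodA d hd (fun m => α (stdE m)) i j * H (stdE j) (stdE i) := by
  set l := lastIdx d hd with hl
  have hsum : ∀ f : Fin d → ℝ, ∑ i, f i = f l + ∑ i ∈ Finset.univ.erase l, f i := fun f =>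
    (Finset.add_sum_erase _ _ (Finset.mem_univ l)).symm
  have hrow : ∀ i ∈ Finset.univ.erase l, ∑ j, hodA d hd (fun m => α (stdE m)) i j * H (stdE j) (stdE i)
      = α (stdE i) / (1 + α (stdE l)) * H (stdE l) (stdE i) + H (stdE i) (stdE i) := by
    intro i hi
    have hil : i ≠ l := Finset.ne_of_mem_erase hi
    rw [hsum]
    congr 1
    · simp [hodA, ← hl, hil]
    · rw [Finset.sum_eq_single_of_mem i hi]
      · simp [hodA, ← hl, hil]
      · intro j hj hji
        have hjl : j ≠ l := Finset.ne_of_mem_erase hj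
        simp [hodA, ← hl, hil, hjl, hji.symm]
  have hlast : ∑ j, hodA d hd (fun m => α (stdE m)) l j * H (stdE j) (stdE l)
      = (1 + ∑ m ∈ Finset.univ.erase l, α (stdE m) ^ 2) / (1 + α (stdE l)) ^ 2
          * H (stdE l) (stdE l)
        + ∑ j ∈ Finset.univ.erase l, α (stdE j) / (1 + α (stdE l)) * H (stdE j) (stdE l) := by
    rw [hsum]
    congr 1
    · simp [hodA, ← hl, tangSq_eq]
    · refine Finset.sum_congr rfl fun j hj => ?_
      have hjl : j ≠ l := Finset.ne_of_mem_erase hj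
      simp [hodA, ← hl, hjl]
  have htr : ∀ m ∈ Finset.univ.erase l, H (frame l m α) (frame l m α)
      = (1 + α (stdE l)) ^ 2 * H (stdE m) (stdE m)
        + (1 + α (stdE l)) * α (stdE m) * (H (stdE m) (stdE l) + H (stdE l) (stdE m))
        + α (stdE m) ^ 2 * H (stdE l) (stdE l) := by
    intro m hm
    rw [frame_of_ne (Finset.ne_of_mem_erase hm)]
    simp
    ring
  rw [hodTr, hsum, frame_self, Finset.sum_congr rfl htr, hsum, hlast, Finset.sum_congr rfl hrow]
  simp only [Finset.sum_add_distrib, mul_add, Finset.mul_sum, add_div, add_mul, Finset.sum_div,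
    Finset.sum_mul]
  have e1 : ∀ a b : ℝ, (1 + α (stdE l)) ^ 2 * (a / (1 + α (stdE l)) * b)
      = (1 + α (stdE l)) * a * b := by
    intro a b; field_simp
  have e2 : ∀ a b : ℝ, (1 + α (stdE l)) ^ 2 * (a / (1 + α (stdE l)) ^ 2 * b) = a * b := by
    intro a b; field_simp
  simp only [e1, e2]
  simp only [add_mul, one_mul, Finset.sum_add_distrib]
  ring

theorem norm_frame_sq_le (hα : ‖α‖ ≤ 1 / 2) : ‖frame l m α‖ ^ 2 ≤ 3 := by
  have hb : ∀ i, |α (stdE i)| ≤ 1 / 2 := fun i => by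
    have := α.le_opNorm (stdE i)
    simp only [PiLp.norm_single, norm_one, mul_one, Real.norm_eq_abs] at this
    linarith
  by_cases h : m = l
  · subst h
    rw [frame_self]; simp
  · rw [frame_of_ne h, EuclideanSpace.norm_sq_eq,
      ← Finset.add_sum_erase _ _ (Finset.mem_univ l),
      Finset.sum_eq_single_of_mem m (by simp [h])]
    · simp [h, Ne.symm h]
      have h1 := abs_le.1 (hb l)
      have h2 := abs_le.1 (hb m)
      simp only [stdE] at h1 h2
      nlinarith
    · intro j hj hjm
      have hjl : j ≠ l := Finset.ne_of_mem_erase hj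
      simp [hjl, hjm]

theorem sum_sq_apply_stdE (α : EuclideanSpace ℝ (Fin d) →L[ℝ] ℝ) :
    ∑ i, α (stdE i) ^ 2 = ‖α‖ ^ 2 := by
  set w := (InnerProductSpace.toDual ℝ (EuclideanSpace ℝ (Fin d))).symm α with hw
  have h1 : ∀ X, α X = inner ℝ w X := fun X => by simp [hw]
  have h2 : ‖α‖ = ‖w‖ := by simp [hw]
  rw [h2, EuclideanSpace.norm_sq_eq]
  refine Finset.sum_congr rfl fun i _ => ?_
  rw [h1, EuclideanSpace.inner_single_right]
  simp

/-- Ellipticity of the frame. -/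
theorem norm_sq_le_sum_inner_frame (hα : ‖α‖ ≤ 1 / 2) (w : EuclideanSpace ℝ (Fin d)) (l : Fin d) :
    ‖w‖ ^ 2 ≤ 10 * ∑ m, inner ℝ w (frame l m α) ^ 2 := by
  have hsum : ∀ f : Fin d → ℝ, ∑ i, f i = f l + ∑ i ∈ Finset.univ.erase l, f i := fun f =>
    (Finset.add_sum_erase _ _ (Finset.mem_univ l)).symm
  have hA := sum_sq_apply_stdE α
  rw [hsum] at hA
  have hA' : ∑ i ∈ Finset.univ.erase l, α (stdE i) ^ 2 ≤ 1 / 4 := by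
    nlinarith [sq_nonneg (α (stdE l)), norm_nonneg α]
  have hs : 1 / 2 ≤ 1 + α (stdE l) := by
    have := α.le_opNorm (stdE l)
    simp only [PiLp.norm_single, norm_one, mul_one, Real.norm_eq_abs] at this
    linarith [(abs_le.1 this).1]
  have hm : ∀ m ∈ Finset.univ.erase l, w m ^ 2 ≤
      8 * inner ℝ w (frame l m α) ^ 2 + 8 * w l ^ 2 * α (stdE m) ^ 2 := by
    intro m hm
    rw [frame_of_ne (Finset.ne_of_mem_erase hm), inner_add_right, inner_smul_right,
      inner_smul_right, EuclideanSpace.inner_single_right, EuclideanSpace.inner_single_right]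
    simp only [conj_trivial, one_mul]
    set s := 1 + α (stdE l)
    have h1 : w m ^ 2 ≤ 4 * (s * w m) ^ 2 := by
      have : 1 / 4 ≤ s ^ 2 := by nlinarith
      nlinarith [sq_nonneg (w m)]
    nlinarith [sq_nonneg (s * w m + 2 * (α (stdE m) * w l))]
  have h2 := Finset.sum_le_sum hm
  rw [Finset.sum_add_distrib, ← Finset.mul_sum, ← Finset.mul_sum] at h2
  rw [EuclideanSpace.norm_sq_eq, hsum, hsum, frame_self, EuclideanSpace.inner_single_right]
  simp only [conj_trivial, one_mul, Real.norm_eq_abs, sq_abs]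
  have h3 : 0 ≤ ∑ i ∈ Finset.univ.erase l, inner ℝ w (frame l i α) ^ 2 :=
    Finset.sum_nonneg fun _ _ => sq_nonneg _
  nlinarith [sq_nonneg (w l)]

end Frame

section Comparison

variable {d : ℕ} {l : Fin d} {K Γ : Set (EuclideanSpace ℝ (Fin d))}
  {z h : EuclideanSpace ℝ (Fin d) → ℝ}

/-- Comparison with a strict subsolution for functions satisfying a linear elliptic equation in the
interior and a quadratic oblique inequality on the flat boundary. -/
theorem hod_comparison (hK : IsCompact K) (hpos : ∀ x ∈ K, 0 ≤ x l)
    (hnhd : ∀ x ∈ K, x ∉ Γ → ∀ᶠ z in 𝓝 x, 0 ≤ z l → z ∈ K)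
    (hz : ∀ x ∈ K, ContDiffAt ℝ 2 z x) (hh : ∀ x ∈ K, ContDiffAt ℝ 2 h x) {κ : ℝ} (hκ : 0 < κ)
    (hzi : ∀ x ∈ K, 0 < x l → ∃ α, ‖α‖ ≤ 1 / 2 ∧ hodTr l α (fderiv ℝ (fderiv ℝ z) x) ≤ 0)
    (hzb : ∀ x ∈ K, x l = 0 →
      fderiv ℝ z x (stdE l) ≤ 1 / 2 * ∑ i ∈ Finset.univ.erase l, fderiv ℝ z x (stdE i) ^ 2)
    (hhi : ∀ x ∈ K, x ∉ Γ → 0 < x l → ∀ α : EuclideanSpace ℝ (Fin d) →L[ℝ] ℝ, ‖α‖ ≤ 1 / 2 →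
      0 < hodTr l α (fderiv ℝ (fderiv ℝ h) x))
    (hhb : ∀ x ∈ K, x ∉ Γ → x l = 0 →
      κ / 2 * ∑ i ∈ Finset.univ.erase l, fderiv ℝ h x (stdE i) ^ 2 < fderiv ℝ h x (stdE l))
    (hΓ : ∀ x ∈ K, x ∈ Γ → κ * h x ≤ z x) : ∀ x ∈ K, κ * h x ≤ z x := by
  intro x₀ hx₀
  have hφ : ∀ x ∈ K, ContDiffAt ℝ 2 (fun y => κ * h y + (-1) * z y) x := fun x hx =>
    (contDiffAt_const.mul (hh x hx)).add (contDiffAt_const.mul (hz x hx))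
  obtain ⟨x, hx, hmax, hcase⟩ := exists_isMaxOn_halfSpace l hK ⟨x₀, hx₀⟩ hpos hnhd hφ
  have hle := hmax x₀ hx₀
  have hch : ContDiffAt ℝ 2 (fun y => κ * h y) x := contDiffAt_const.mul (hh x hx)
  have hcz : ContDiffAt ℝ 2 (fun y => (-1) * z y) x := contDiffAt_const.mul (hz x hx)
  have hd1 : fderiv ℝ (fun y => κ * h y + (-1) * z y) x = κ • fderiv ℝ h x - fderiv ℝ z x := by
    rw [fderiv_fun_add (hch.differentiableAt (by simp)) (hcz.differentiableAt (by simp)),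
      fderiv_const_mul ((hh x hx).differentiableAt (by simp)),
      fderiv_const_mul ((hz x hx).differentiableAt (by simp))]
    module
  have hd2 : fderiv ℝ (fderiv ℝ (fun y => κ * h y + (-1) * z y)) x
      = κ • fderiv ℝ (fderiv ℝ h) x - fderiv ℝ (fderiv ℝ z) x := by
    rw [hessian_add hch hcz, hessian_const_mul _ (hh x hx), hessian_const_mul _ (hz x hx)]
    module
  rcases hcase with hG | ⟨hG, hl, -, h2⟩ | ⟨hG, hl, h1⟩
  · have := hΓ x hx hG
    linarith
  · exfalso
    obtain ⟨α, hα, hzα⟩ := hzi x hx hl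
    have hhα := hhi x hx hG hl α hα
    have : κ * hodTr l α (fderiv ℝ (fderiv ℝ h) x) ≤ hodTr l α (fderiv ℝ (fderiv ℝ z) x) := by
      rw [hodTr, hodTr, Finset.mul_sum]
      refine Finset.sum_le_sum fun m _ => ?_
      have := h2 (frame l m α)
      rw [hd2] at this
      simpa using this
    nlinarith
  · exfalso
    rw [hd1] at h1
    have htan : ∀ i ∈ Finset.univ.erase l, fderiv ℝ z x (stdE i) ^ 2
        = κ ^ 2 * fderiv ℝ h x (stdE i) ^ 2 := by
      intro i hi
      have hil : l ≠ i := (Finset.ne_of_mem_erase hi).symm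
      have a := h1 (stdE i) (by simp [hil])
      have b := h1 (-stdE i) (by simp [hil])
      simp only [sub_apply, smul_apply, map_neg,
        smul_eq_mul] at a b
      have : fderiv ℝ z x (stdE i) = κ * fderiv ℝ h x (stdE i) := by linarith
      rw [this]; ring
    have hn := h1 (stdE l) (by simp)
    simp only [sub_apply, smul_apply, smul_eq_mul] at hn
    have hzb' := hzb x hx hl
    rw [Finset.sum_congr rfl htan, ← Finset.mul_sum] at hzb'
    have := mul_lt_mul_of_pos_left (hhb x hx hG hl) hκ
    nlinarith

end Comparison

/-- The pointwise conditions used in minimum principles: a linear elliptic inequality in the interior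
and a quadratic oblique inequality on the flat boundary. -/
def IsHodMin {d : ℕ} (l : Fin d) (z : EuclideanSpace ℝ (Fin d) → ℝ) (x : EuclideanSpace ℝ (Fin d)) :
    Prop :=
  ContDiffAt ℝ 2 z x ∧
  (0 < x l → ∃ α, ‖α‖ ≤ 1 / 2 ∧ hodTr l α (fderiv ℝ (fderiv ℝ z) x) ≤ 0) ∧
  (x l = 0 → fderiv ℝ z x (stdE l) ≤ 1 / 2 * ∑ i ∈ Finset.univ.erase l, fderiv ℝ z x (stdE i) ^ 2)

section MinPrinciple

variable {d : ℕ} {l : Fin d} {z : EuclideanSpace ℝ (Fin d) → ℝ}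

theorem IsHodMin.sub_const {x : EuclideanSpace ℝ (Fin d)} (hz : IsHodMin l z x) (a : ℝ) :
    IsHodMin l (fun y => z y - a) x := by
  refine ⟨hz.1.sub contDiffAt_const, ?_, ?_⟩
  · rw [hessian_sub_const]; exact hz.2.1
  · simp only [fderiv_sub_const]; exact hz.2.2

theorem abs_apply_le_norm (x : EuclideanSpace ℝ (Fin d)) (i : Fin d) : |x i| ≤ ‖x‖ := by
  simpa using PiLp.norm_apply_le x i

theorem fderiv_coord (l : Fin d) (x X : EuclideanSpace ℝ (Fin d)) :
    fderiv ℝ (fun y : EuclideanSpace ℝ (Fin d) => y l) x X = X l := by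
  have : HasFDerivAt (fun y : EuclideanSpace ℝ (Fin d) => y l)
      (EuclideanSpace.proj l : EuclideanSpace ℝ (Fin d) →L[ℝ] ℝ) x :=
    (EuclideanSpace.proj l : EuclideanSpace ℝ (Fin d) →L[ℝ] ℝ).hasFDerivAt
  rw [this.fderiv]; rfl

theorem hessian_coord (l : Fin d) (x : EuclideanSpace ℝ (Fin d)) :
    fderiv ℝ (fderiv ℝ (fun y : EuclideanSpace ℝ (Fin d) => y l)) x = 0 := by
  have : fderiv ℝ (fun y : EuclideanSpace ℝ (Fin d) => y l)
      = fun _ => (EuclideanSpace.proj l : EuclideanSpace ℝ (Fin d) →L[ℝ] ℝ) := by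
    ext y X; rw [fderiv_coord]; rfl
  rw [this]; simp

theorem contDiffAt_coord (l : Fin d) (x : EuclideanSpace ℝ (Fin d)) (n : WithTop ℕ∞) :
    ContDiffAt ℝ n (fun y : EuclideanSpace ℝ (Fin d) => y l) x :=
  (EuclideanSpace.proj l : EuclideanSpace ℝ (Fin d) →L[ℝ] ℝ).contDiff.contDiffAt

theorem isCompact_annulus (l : Fin d) (c : EuclideanSpace ℝ (Fin d)) (r₁ r₂ : ℝ) :
    IsCompact {y : EuclideanSpace ℝ (Fin d) | 0 ≤ y l ∧ r₁ ≤ ‖y - c‖ ∧ ‖y - c‖ ≤ r₂} := by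
  refine (isCompact_closedBall c r₂).of_isClosed_subset ?_ fun y hy => ?_
  · have h1 : IsClosed {y : EuclideanSpace ℝ (Fin d) | 0 ≤ y l} :=
      isClosed_le continuous_const (by fun_prop)
    have h2 : IsClosed {y : EuclideanSpace ℝ (Fin d) | r₁ ≤ ‖y - c‖} :=
      isClosed_le continuous_const (by fun_prop)
    have h3 : IsClosed {y : EuclideanSpace ℝ (Fin d) | ‖y - c‖ ≤ r₂} :=
      isClosed_le (by fun_prop) continuous_const
    exact h1.inter (h2.inter h3)
  · rw [mem_closedBall_iff_norm]; exact hy.2.2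

theorem eventually_mem_annulus (l : Fin d) {c x : EuclideanSpace ℝ (Fin d)} {r₁ r₂ : ℝ}
    (hx : x ∈ {y : EuclideanSpace ℝ (Fin d) | 0 ≤ y l ∧ r₁ ≤ ‖y - c‖ ∧ ‖y - c‖ ≤ r₂})
    (hG : x ∉ {y : EuclideanSpace ℝ (Fin d) | ‖y - c‖ = r₁ ∨ ‖y - c‖ = r₂}) :
    ∀ᶠ y in 𝓝 x, 0 ≤ y l →
      y ∈ {y : EuclideanSpace ℝ (Fin d) | 0 ≤ y l ∧ r₁ ≤ ‖y - c‖ ∧ ‖y - c‖ ≤ r₂} := by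
  simp only [mem_ofPred_eq, not_or] at hx hG
  have hc : ContinuousAt (fun y => ‖y - c‖) x := by fun_prop
  filter_upwards [hc.eventually (lt_mem_nhds (lt_of_le_of_ne hx.2.1 (Ne.symm hG.1))),
    hc.eventually (gt_mem_nhds (lt_of_le_of_ne hx.2.2 hG.2))] with y h1 h2 h0
  exact ⟨h0, h1.le, h2.le⟩

theorem sum_frame_norm_sq_pos (l : Fin d) (α : EuclideanSpace ℝ (Fin d) →L[ℝ] ℝ) :
    0 < ∑ m, ‖frame l m α‖ ^ 2 := by
  refine lt_of_lt_of_le ?_ (Finset.single_le_sum (f := fun m => ‖frame l m α‖ ^ 2)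
    (fun _ _ => sq_nonneg _) (Finset.mem_univ l))
  simp [frame_self]

theorem sum_erase_sq_le (l : Fin d) (w : EuclideanSpace ℝ (Fin d)) :
    ∑ i ∈ Finset.univ.erase l, w i ^ 2 ≤ ‖w‖ ^ 2 := by
  rw [EuclideanSpace.norm_sq_eq]
  simp only [Real.norm_eq_abs, sq_abs]
  exact Finset.sum_le_sum_of_subset_of_nonneg (Finset.erase_subset _ _) fun _ _ _ => sq_nonneg _

/-- The minimum principle on half annuli. -/
theorem hod_min_principle {r₁ r₂ a : ℝ}
    (hz : ∀ x, 0 ≤ x l → r₁ ≤ ‖x‖ → ‖x‖ ≤ r₂ → IsHodMin l z x)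
    (h₁ : ∀ x, 0 ≤ x l → ‖x‖ = r₁ → a ≤ z x) (h₂ : ∀ x, 0 ≤ x l → ‖x‖ = r₂ → a ≤ z x)
    {x : EuclideanSpace ℝ (Fin d)} (hxl : 0 ≤ x l) (hx₁ : r₁ ≤ ‖x‖) (hx₂ : ‖x‖ ≤ r₂) : a ≤ z x := by
  have hr₂ : 0 ≤ r₂ := (norm_nonneg x).trans hx₂
  set K := {y : EuclideanSpace ℝ (Fin d) | 0 ≤ y l ∧ r₁ ≤ ‖y - 0‖ ∧ ‖y - 0‖ ≤ r₂} with hK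
  set Γ := {y : EuclideanSpace ℝ (Fin d) | ‖y - 0‖ = r₁ ∨ ‖y - 0‖ = r₂} with hΓ
  set h : EuclideanSpace ℝ (Fin d) → ℝ := fun y => (‖y - 0‖ ^ 2 + y l) - (r₂ ^ 2 + r₂) with hh
  have hq := fun y => contDiffAt_norm_sub_sq (0 : EuclideanSpace ℝ (Fin d)) y 2
  have hl := fun y => contDiffAt_coord l y 2
  have hd1 : ∀ y X, fderiv ℝ h y X = 2 * inner ℝ y X + X l := by
    intro y X
    rw [hh, fderiv_sub_const, fderiv_fun_add ((hq y).differentiableAt (by simp))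
      ((hl y).differentiableAt (by simp)), add_apply, fderiv_norm_sub_sq,
      fderiv_coord, sub_zero]
  have hd2 : ∀ y X, fderiv ℝ (fderiv ℝ h) y X X = 2 * ‖X‖ ^ 2 := by
    intro y X
    rw [hh, hessian_sub_const, hessian_add (hq y) (hl y), hessian_coord, add_zero,
      hessian_norm_sub_sq, real_inner_self_eq_norm_sq]
  have key : ∀ κ : ℝ, 0 < κ → κ * (2 * r₂ ^ 2) < 1 → κ * h x ≤ z x - a := by
    intro κ hκ hκ2
    refine hod_comparison (l := l) (K := K) (Γ := Γ) (z := fun y => z y - a) (h := h)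
      (isCompact_annulus l 0 r₁ r₂) (fun y hy => hy.1)
      (fun y hy hG => eventually_mem_annulus l hy hG) ?_ ?_ hκ ?_ ?_ ?_ ?_ ?_ x ?_
    · intro y hy
      simp only [hK, sub_zero, mem_ofPred_eq] at hy
      exact ((hz y hy.1 hy.2.1 hy.2.2).sub_const a).1
    · intro y _
      exact ((hq y).add (hl y)).sub contDiffAt_const
    · intro y hy
      simp only [hK, sub_zero, mem_ofPred_eq] at hy
      exact ((hz y hy.1 hy.2.1 hy.2.2).sub_const a).2.1
    · intro y hy
      simp only [hK, sub_zero, mem_ofPred_eq] at hy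
      exact ((hz y hy.1 hy.2.1 hy.2.2).sub_const a).2.2
    · intro y _ _ _ α _
      simp only [hodTr, hd2, ← Finset.mul_sum]
      have := sum_frame_norm_sq_pos l α
      linarith
    · intro y hy _ hyl
      simp only [hK, sub_zero, mem_ofPred_eq] at hy
      have e1 : ∀ i ∈ Finset.univ.erase l, fderiv ℝ h y (stdE i) ^ 2 = 4 * y i ^ 2 := by
        intro i hi
        have : l ≠ i := (Finset.ne_of_mem_erase hi).symm
        rw [hd1, EuclideanSpace.inner_single_right]
        simp [this]
        ring
      rw [Finset.sum_congr rfl e1, hd1, EuclideanSpace.inner_single_right, ← Finset.mul_sum]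
      have e2 := sum_erase_sq_le l y
      have e3 : ‖y‖ ^ 2 ≤ r₂ ^ 2 := by gcongr; exact hy.2.2
      have e4 : κ / 2 * (4 * ∑ i ∈ Finset.univ.erase l, y i ^ 2) < 1 := by nlinarith
      refine e4.trans_eq ?_
      simp [hyl]
    · intro y hy hG
      simp only [hK, sub_zero, mem_ofPred_eq] at hy
      simp only [hΓ, sub_zero, mem_ofPred_eq] at hG
      have e1 : a ≤ z y := hG.elim (h₁ y hy.1) (h₂ y hy.1)
      have e2 : h y ≤ 0 := by
        have e3 : ‖y‖ ^ 2 ≤ r₂ ^ 2 := by gcongr; exact hy.2.2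
        have := (abs_le.1 (abs_apply_le_norm y l)).2
        simp only [hh, sub_zero]
        linarith
      have : κ * h y ≤ 0 := mul_nonpos_of_nonneg_of_nonpos hκ.le e2
      linarith
    · simp only [hK, sub_zero, mem_ofPred_eq]
      exact ⟨hxl, hx₁, hx₂⟩
  have hlim : Tendsto (fun κ : ℝ => κ * h x) (𝓝[>] 0) (𝓝 0) := by
    have : Continuous fun κ : ℝ => κ * h x := by fun_prop
    simpa using (this.tendsto 0).mono_left nhdsWithin_le_nhds
  have hev : ∀ᶠ κ : ℝ in 𝓝[>] 0, κ * h x ≤ z x - a := by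
    have hc : Continuous fun κ : ℝ => κ * (2 * r₂ ^ 2) := by fun_prop
    have h3 : ∀ᶠ κ : ℝ in 𝓝 0, κ * (2 * r₂ ^ 2) < 1 :=
      (hc.tendsto 0).eventually (gt_mem_nhds (by simp))
    filter_upwards [self_mem_nhdsWithin, nhdsWithin_le_nhds h3] with κ h0 h4
    exact key κ h0 h4
  linarith [le_of_tendsto hlim hev]

/-- The factor lost in one step of the propagation of positivity. -/
def hodGain (d : ℕ) : ℝ := Real.exp (-(64 * d)) - Real.exp (-(256 * d))

theorem hodGain_pos (hd : 0 < d) : 0 < hodGain d := by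
  have : (0 : ℝ) < d := by exact_mod_cast hd
  rw [hodGain, sub_pos, Real.exp_lt_exp]
  linarith

theorem hodGain_le_one : hodGain d ≤ 1 := by
  have h1 : Real.exp (-(64 * d : ℝ)) ≤ 1 := Real.exp_le_one_iff.2 (by
    have : (0 : ℝ) ≤ d := Nat.cast_nonneg d
    linarith)
  have h2 := Real.exp_pos (-(256 * d : ℝ))
  rw [hodGain]; linarith

/-- Positivity propagates from a ball to the concentric ball of twice the radius. -/
theorem hod_growth {x₀ : EuclideanSpace ℝ (Fin d)} {ρ c : ℝ} (hρ : 0 < ρ) (hc : 0 < c) (hcρ : c ≤ ρ)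
    (hx₀ : ρ ≤ x₀ l) (hz : ∀ x, 0 ≤ x l → ‖x - x₀‖ ≤ 4 * ρ → IsHodMin l z x)
    (hz0 : ∀ x, 0 ≤ x l → ‖x - x₀‖ ≤ 4 * ρ → 0 ≤ z x)
    (hzc : ∀ x, 0 ≤ x l → ‖x - x₀‖ ≤ ρ → c ≤ z x)
    {x : EuclideanSpace ℝ (Fin d)} (hxl : 0 ≤ x l) (hx : ‖x - x₀‖ ≤ 2 * ρ) :
    hodGain d * c ≤ z x := by
  have hd : 0 < d := l.pos
  have hd' : (1 : ℝ) ≤ d := by exact_mod_cast hd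
  rcases le_total ‖x - x₀‖ ρ with hxρ | hxρ
  · have := hzc x hxl hxρ
    nlinarith [hodGain_le_one (d := d)]
  set a : ℝ := 16 * d / ρ ^ 2 with ha
  have haρ : a * ρ ^ 2 = 16 * d := by rw [ha]; field_simp
  have ha0 : 0 < a := by positivity
  set K := {y : EuclideanSpace ℝ (Fin d) | 0 ≤ y l ∧ ρ ≤ ‖y - x₀‖ ∧ ‖y - x₀‖ ≤ 4 * ρ} with hK
  set Γ := {y : EuclideanSpace ℝ (Fin d) | ‖y - x₀‖ = ρ ∨ ‖y - x₀‖ = 4 * ρ} with hΓ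
  set h : EuclideanSpace ℝ (Fin d) → ℝ :=
    fun y => Real.exp (-a * ‖y - x₀‖ ^ 2) - Real.exp (-(256 * d)) with hh
  have hq := fun y => contDiffAt_norm_sub_sq x₀ y 2
  have hg : ∀ y, ContDiffAt ℝ 2 (fun y => -a * ‖y - x₀‖ ^ 2) y := fun y =>
    contDiffAt_const.mul (hq y)
  have hg1 : ∀ y X, fderiv ℝ (fun y => -a * ‖y - x₀‖ ^ 2) y X = -a * (2 * inner ℝ (y - x₀) X) := by
    intro y X
    rw [fderiv_const_mul ((hq y).differentiableAt (by simp)), smul_apply,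
      fderiv_norm_sub_sq, smul_eq_mul]
  have hd1 : ∀ y X, fderiv ℝ h y X
      = Real.exp (-a * ‖y - x₀‖ ^ 2) * (-a * (2 * inner ℝ (y - x₀) X)) := by
    intro y X
    rw [hh, fderiv_sub_const, fderiv_exp ((hg y).differentiableAt (by simp)),
      smul_apply, hg1, smul_eq_mul]
  have hd2 : ∀ y X, fderiv ℝ (fderiv ℝ h) y X X
      = Real.exp (-a * ‖y - x₀‖ ^ 2) * (-(2 * a) * ‖X‖ ^ 2 + 4 * a ^ 2 * inner ℝ (y - x₀) X ^ 2) := by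
    intro y X
    rw [hh, hessian_sub_const, hessian_exp (hg y), hessian_const_mul _ (hq y), hg1,
      smul_apply, smul_apply, hessian_norm_sub_sq,
      real_inner_self_eq_norm_sq, smul_eq_mul]
    ring
  have hcomp : c * h x ≤ z x := by
    refine hod_comparison (l := l) (K := K) (Γ := Γ) (z := z) (h := h)
      (isCompact_annulus l x₀ ρ (4 * ρ)) (fun y hy => hy.1)
      (fun y hy hG => eventually_mem_annulus l hy hG)
      (fun y hy => (hz y hy.1 hy.2.2).1) (fun y _ => (hg y).exp.sub contDiffAt_const) hc
      (fun y hy => (hz y hy.1 hy.2.2).2.1) (fun y hy => (hz y hy.1 hy.2.2).2.2) ?_ ?_ ?_ x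
      ⟨hxl, hxρ, by linarith⟩
    · intro y hy _ _ α hα
      simp only [hodTr, hd2, ← Finset.mul_sum]
      refine mul_pos (Real.exp_pos _) ?_
      rw [Finset.sum_add_distrib, ← Finset.mul_sum, ← Finset.mul_sum]
      have e1 : ∑ m, ‖frame l m α‖ ^ 2 ≤ 3 * d := by
        refine (Finset.sum_le_sum fun m _ => norm_frame_sq_le hα).trans ?_
        simp [mul_comm]
      have e2 := norm_sq_le_sum_inner_frame hα (y - x₀) l
      have e3 : ρ ^ 2 ≤ ‖y - x₀‖ ^ 2 := by gcongr; exact hy.2.1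
      have e4 : 16 * d ≤ a * (10 * ∑ m, inner ℝ (y - x₀) (frame l m α) ^ 2) := by
        rw [← haρ]; gcongr; linarith
      have e5 : 0 < a * (4 * (a * ∑ m, inner ℝ (y - x₀) (frame l m α) ^ 2)
          - 2 * ∑ m, ‖frame l m α‖ ^ 2) := by
        apply mul_pos ha0; linarith
      linarith
    · intro y hy _ hyl
      set t := a * ‖y - x₀‖ ^ 2 with ht
      have e0 : -a * ‖y - x₀‖ ^ 2 = -t := by rw [ht]; ring
      have e1 : ∀ i ∈ Finset.univ.erase l, fderiv ℝ h y (stdE i) ^ 2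
          = (2 * a * Real.exp (-t)) ^ 2 * (y - x₀) i ^ 2 := by
        intro i hi
        rw [hd1, EuclideanSpace.inner_single_right, e0]
        simp
        ring
      rw [Finset.sum_congr rfl e1, hd1, EuclideanSpace.inner_single_right, ← Finset.mul_sum, e0]
      have e2 := sum_erase_sq_le l (y - x₀)
      have e3 : t * Real.exp (-t) < 1 := by
        have h5 := Real.add_one_le_exp t
        rw [Real.exp_neg, ← div_eq_mul_inv, div_lt_one (Real.exp_pos t)]
        linarith
      have e4 : c / 2 * ((2 * a * Real.exp (-t)) ^ 2 * ∑ i ∈ Finset.univ.erase l, (y - x₀) i ^ 2)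
          ≤ c / 2 * ((2 * a * Real.exp (-t)) ^ 2 * ‖y - x₀‖ ^ 2) := by gcongr
      have e5 : c / 2 * ((2 * a * Real.exp (-t)) ^ 2 * ‖y - x₀‖ ^ 2)
          = 2 * a * Real.exp (-t) * (c * (t * Real.exp (-t))) := by rw [ht]; ring
      have e6 : c * (t * Real.exp (-t)) < x₀ l := by nlinarith
      have e7 : 2 * a * Real.exp (-t) * (c * (t * Real.exp (-t))) < 2 * a * Real.exp (-t) * x₀ l :=
        mul_lt_mul_of_pos_left e6 (by positivity)
      refine (e4.trans_eq e5).trans_lt (e7.trans_eq ?_)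
      simp [hyl]
      ring
    · intro y hy hG
      rcases hG with hG | hG
      · have e1 := hzc y hy.1 hG.le
        have e2 : h y ≤ 1 := by
          have : Real.exp (-a * ‖y - x₀‖ ^ 2) ≤ 1 := Real.exp_le_one_iff.2 (by
            have := mul_nonneg ha0.le (sq_nonneg ‖y - x₀‖)
            linarith)
          have := Real.exp_pos (-(256 * d : ℝ))
          simp only [hh]; linarith
        nlinarith
      · have e1 := hz0 y hy.1 hy.2.2
        have e2 : h y = 0 := by
          have : -a * (4 * ρ) ^ 2 = -(256 * d) := by linear_combination (-16) * haρ
          simp only [hh, hG, this, sub_self]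
        rw [e2, mul_zero]; exact e1
  refine le_trans ?_ hcomp
  rw [mul_comm]
  refine mul_le_mul_of_nonneg_left ?_ hc.le
  rw [hodGain]
  refine sub_le_sub_right (Real.exp_le_exp.2 ?_) _
  have : ‖x - x₀‖ ^ 2 ≤ (2 * ρ) ^ 2 := by gcongr
  have := mul_le_mul_of_nonneg_left this ha0.le
  nlinarith

end MinPrinciple

section Harnack

variable {d : ℕ} {l : Fin d} {z : EuclideanSpace ℝ (Fin d) → ℝ}

/-- Propagation of positivity along a segment. -/
theorem hod_segment {a b : EuclideanSpace ℝ (Fin d)} {ρ c R : ℝ} {n : ℕ} (hn : 0 < n) (hρ : 0 < ρ)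
    (hc : 0 < c) (hcρ : c ≤ ρ) (hz : ∀ x, 0 ≤ x l → R ≤ ‖x‖ → IsHodMin l z x)
    (hz0 : ∀ x, 0 ≤ x l → R ≤ ‖x‖ → 0 ≤ z x)
    (hseg : ∀ t : ℝ, 0 ≤ t → t ≤ 1 →
      ρ ≤ (a + t • (b - a)) l ∧ R + 4 * ρ ≤ ‖a + t • (b - a)‖)
    (hab : ‖b - a‖ ≤ n * ρ) (ha : ∀ x, 0 ≤ x l → ‖x - a‖ ≤ ρ → c ≤ z x)
    {x : EuclideanSpace ℝ (Fin d)} (hxl : 0 ≤ x l) (hx : ‖x - b‖ ≤ ρ) :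
    hodGain d ^ n * c ≤ z x := by
  have hn' : (0 : ℝ) < n := by exact_mod_cast hn
  have hg0 := hodGain_pos l.pos
  have hg1 := hodGain_le_one (d := d)
  have key : ∀ k : ℕ, k ≤ n → ∀ x : EuclideanSpace ℝ (Fin d), 0 ≤ x l →
      ‖x - (a + ((k : ℝ) / n) • (b - a))‖ ≤ ρ → hodGain d ^ k * c ≤ z x := by
    intro k
    induction k with
    | zero => intro _ x hxl hx; simpa using ha x hxl (by simpa using hx)
    | succ k ih =>
      intro hk x hxl hx
      have hkn : (k : ℝ) + 1 ≤ n := by exact_mod_cast hk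
      obtain ⟨h1, h2⟩ := hseg ((k : ℝ) / n) (by positivity) ((div_le_one hn').2 (by linarith))
      set p := a + ((k : ℝ) / n) • (b - a) with hp
      have hfar : ∀ x, ‖x - p‖ ≤ 4 * ρ → R ≤ ‖x‖ := fun x hx => by
        have := norm_sub_norm_le p x
        rw [norm_sub_rev] at this
        linarith
      have hpow : hodGain d ^ k ≤ 1 := pow_le_one₀ hg0.le hg1
      have hpow0 : 0 < hodGain d ^ k := pow_pos hg0 k
      rw [pow_succ, mul_comm (hodGain d ^ k), mul_assoc]
      refine hod_growth (x₀ := p) hρ (mul_pos hpow0 hc) (by nlinarith) h1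
        (fun x hxl hx => hz x hxl (hfar x hx)) (fun x hxl hx => hz0 x hxl (hfar x hx))
        (ih (by omega)) hxl ?_
      have e1 : x - p = (x - (a + (((k + 1 : ℕ) : ℝ) / n) • (b - a))) + (1 / (n : ℝ)) • (b - a) := by
        rw [hp]; push_cast; module
      have e2 : ‖(1 / (n : ℝ)) • (b - a)‖ ≤ ρ := by
        rw [norm_smul, Real.norm_of_nonneg (by positivity), one_div, inv_mul_le_iff₀ hn']
        exact hab
      rw [e1]
      linarith [norm_add_le (x - (a + (((k + 1 : ℕ) : ℝ) / n) • (b - a))) ((1 / (n : ℝ)) • (b - a))]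
  refine key n le_rfl x hxl ?_
  rw [div_self hn'.ne', one_smul, add_sub_cancel]
  exact hx

theorem norm_le_norm_add_smul_stdE {y : EuclideanSpace ℝ (Fin d)} (hy : 0 ≤ y l) {s : ℝ} (hs : 0 ≤ s) :
    ‖y‖ ≤ ‖y + s • stdE l‖ := by
  have h1 : ‖y + s • stdE l‖ ^ 2 = ‖y‖ ^ 2 + 2 * (s * y l) + s ^ 2 := by
    rw [norm_add_sq_real, inner_smul_right, EuclideanSpace.inner_single_right, norm_smul]
    simp
  have h2 := mul_nonneg hs hy
  refine (sq_le_sq₀ (norm_nonneg _) (norm_nonneg _)).1 ?_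
  nlinarith [sq_nonneg s]

/-- A weak Harnack inequality on a half sphere. -/
theorem hod_harnack {y₀ y₁ : EuclideanSpace ℝ (Fin d)} {ρ c R : ℝ} {n : ℕ} (hn : 0 < n) (hρ : 0 < ρ)
    (hc : 0 < c) (hcρ : c ≤ ρ) (hR : 8 * ρ ≤ R) (hnR : 2 * R ≤ n * ρ)
    (hz : ∀ x, 0 ≤ x l → R / 2 ≤ ‖x‖ → IsHodMin l z x)
    (hz0 : ∀ x, 0 ≤ x l → R / 2 ≤ ‖x‖ → 0 ≤ z x)
    (hy₀ : 0 ≤ y₀ l) (hy₁ : 0 ≤ y₁ l) (hy₀R : ‖y₀‖ = R) (hy₁R : ‖y₁‖ = R)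
    (h : ∀ x, 0 ≤ x l → ‖x - y₀‖ ≤ 2 * ρ → c ≤ z x) :
    hodGain d ^ (3 * n) * c ≤ z y₁ := by
  have hg0 := hodGain_pos l.pos
  have hg1 := hodGain_le_one (d := d)
  have hpow : ∀ k, hodGain d ^ k * c ≤ ρ := fun k => by
    have := pow_le_one₀ hg0.le hg1 (n := k)
    nlinarith
  have hpow0 : ∀ k, 0 < hodGain d ^ k * c := fun k => mul_pos (pow_pos hg0 k) hc
  have hse : ‖(stdE l : EuclideanSpace ℝ (Fin d))‖ = 1 := by simp
  have hvert : ∀ y : EuclideanSpace ℝ (Fin d), 0 ≤ y l → ‖y‖ = R → ∀ s : ℝ, ρ ≤ s →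
      ρ ≤ (y + s • stdE l) l ∧ R / 2 + 4 * ρ ≤ ‖y + s • stdE l‖ := by
    intro y hy hyR s hs
    refine ⟨by simp; linarith, ?_⟩
    have := norm_le_norm_add_smul_stdE hy (hρ.le.trans hs)
    linarith
  have s1 := fun x => hod_segment (a := y₀ + ρ • stdE l) (b := y₀ + R • stdE l) (x := x) hn hρ hc hcρ hz
    hz0 (fun t ht0 ht1 => by
      have e : y₀ + ρ • stdE l + t • (y₀ + R • stdE l - (y₀ + ρ • stdE l))
          = y₀ + (ρ + t * (R - ρ)) • stdE l := by module
      rw [e]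
      exact hvert y₀ hy₀ hy₀R _ (by nlinarith))
    (by
      have e : y₀ + R • stdE l - (y₀ + ρ • stdE l) = (R - ρ) • stdE l := by module
      rw [e, norm_smul, hse, Real.norm_of_nonneg (by linarith)]
      linarith)
    (fun x hxl hx => h x hxl (by
      have e : x - y₀ = (x - (y₀ + ρ • stdE l)) + ρ • stdE l := by module
      have e2 : ‖ρ • (stdE l : EuclideanSpace ℝ (Fin d))‖ = ρ := by
        rw [norm_smul, hse, Real.norm_of_nonneg hρ.le, mul_one]
      rw [e]
      linarith [norm_add_le (x - (y₀ + ρ • stdE l)) (ρ • stdE l)]))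
  have s2 := fun x => hod_segment (a := y₀ + R • stdE l) (b := y₁ + R • stdE l) (x := x) hn hρ (hpow0 n)
    (hpow n) hz hz0 (fun t ht0 ht1 => by
      have e : R ≤ (y₀ + R • stdE l + t • (y₁ + R • stdE l - (y₀ + R • stdE l))) l := by
        simp
        nlinarith
      refine ⟨by linarith, ?_⟩
      have := (le_abs_self _).trans (abs_apply_le_norm
        (y₀ + R • stdE l + t • (y₁ + R • stdE l - (y₀ + R • stdE l))) l)
      linarith)
    (by
      have e : y₁ + R • stdE l - (y₀ + R • stdE l) = y₁ - y₀ := by module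
      rw [e]
      linarith [norm_sub_le y₁ y₀])
    s1
  have s3 := hod_segment (a := y₁ + R • stdE l) (b := y₁ + ρ • stdE l) (x := y₁) hn hρ
    (c := hodGain d ^ n * (hodGain d ^ n * c)) (mul_pos (pow_pos hg0 n) (hpow0 n))
    (by have := hpow (n + n); rwa [pow_add, mul_assoc] at this) hz hz0
    (fun t ht0 ht1 => by
      have e : y₁ + R • stdE l + t • (y₁ + ρ • stdE l - (y₁ + R • stdE l))
          = y₁ + (ρ + (1 - t) * (R - ρ)) • stdE l := by module
      rw [e]
      exact hvert y₁ hy₁ hy₁R _ (by nlinarith))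
    (by
      have e : y₁ + ρ • stdE l - (y₁ + R • stdE l) = -((R - ρ) • stdE l) := by module
      rw [e, norm_neg, norm_smul, hse, Real.norm_of_nonneg (by linarith)]
      linarith)
    s2 hy₁ (by
      have e : y₁ - (y₁ + ρ • stdE l) = -(ρ • stdE l) := by module
      rw [e, norm_neg, norm_smul, hse, Real.norm_of_nonneg hρ.le, mul_one])
  have e : hodGain d ^ (3 * n) * c = hodGain d ^ n * (hodGain d ^ n * (hodGain d ^ n * c)) := by ring
  rw [e]; exact s3

end Harnack

/-- The linearisation of the hodograph operator at `v`, applied to `f`. -/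
def linTr {d : ℕ} (l : Fin d) (v f : EuclideanSpace ℝ (Fin d) → ℝ) (x : EuclideanSpace ℝ (Fin d)) : ℝ :=
  ∑ m, (fderiv ℝ (fderiv ℝ f) x (frame l m (fderiv ℝ v x)) (frame l m (fderiv ℝ v x)) +
    2 * fderiv ℝ (fderiv ℝ v) x (frame l m (fderiv ℝ v x)) (frameLin l m (fderiv ℝ f x)))

/-- The bilinear form on gradients attached to the frame of `v`. -/
def carre {d : ℕ} (l : Fin d) (v f g : EuclideanSpace ℝ (Fin d) → ℝ)
    (x : EuclideanSpace ℝ (Fin d)) : ℝ :=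
  ∑ m, fderiv ℝ f x (frame l m (fderiv ℝ v x)) * fderiv ℝ g x (frame l m (fderiv ℝ v x))

section Linearised

variable {d : ℕ} {l : Fin d} {v f g : EuclideanSpace ℝ (Fin d) → ℝ} {x : EuclideanSpace ℝ (Fin d)}

theorem linTr_add (hf : ContDiffAt ℝ 2 f x) (hg : ContDiffAt ℝ 2 g x) :
    linTr l v (fun y => f y + g y) x = linTr l v f x + linTr l v g x := by
  simp only [linTr, hessian_add hf hg, add_apply,
    fderiv_fun_add (hf.differentiableAt (by simp)) (hg.differentiableAt (by simp)), map_add]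
  rw [← Finset.sum_add_distrib]
  exact Finset.sum_congr rfl fun m _ => by ring

theorem linTr_const_mul (c : ℝ) (hf : ContDiffAt ℝ 2 f x) :
    linTr l v (fun y => c * f y) x = c * linTr l v f x := by
  simp only [linTr, hessian_const_mul c hf, smul_apply,
    fderiv_const_mul (hf.differentiableAt (by simp)), map_smul, smul_eq_mul, Finset.mul_sum]
  exact Finset.sum_congr rfl fun m _ => by ring

theorem linTr_const (c : ℝ) : linTr l v (fun _ => c) x = 0 := by
  have : fderiv ℝ (fun _ : EuclideanSpace ℝ (Fin d) => c) = fun _ => 0 := by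
    ext; simp
  simp [linTr, this]

theorem linTr_sub_const (c : ℝ) : linTr l v (fun y => f y - c) x = linTr l v f x := by
  simp only [linTr, hessian_sub_const, fderiv_sub_const]

theorem linTr_mul (hf : ContDiffAt ℝ 2 f x) (hg : ContDiffAt ℝ 2 g x) :
    linTr l v (fun y => f y * g y) x
      = f x * linTr l v g x + g x * linTr l v f x + 2 * carre l v f g x := by
  simp only [linTr, carre, hessian_mul hf hg,
    fderiv_fun_mul (hf.differentiableAt (by simp)) (hg.differentiableAt (by simp)), map_add, map_smul,
    smul_eq_mul, Finset.mul_sum]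
  rw [← Finset.sum_add_distrib, ← Finset.sum_add_distrib]
  exact Finset.sum_congr rfl fun m _ => by ring

theorem linTr_sum {ι : Type*} (s : Finset ι) {F : ι → EuclideanSpace ℝ (Fin d) → ℝ}
    (hF : ∀ i ∈ s, ContDiffAt ℝ 2 (F i) x) :
    linTr l v (fun y => ∑ i ∈ s, F i y) x = ∑ i ∈ s, linTr l v (F i) x := by
  classical
  induction s using Finset.induction_on with
  | empty => simpa using linTr_const (l := l) (v := v) (x := x) 0
  | insert a s ha ih =>
    simp only [Finset.sum_insert ha]
    rw [linTr_add (hF a (Finset.mem_insert_self a s))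
      (ContDiffAt.sum fun i hi => hF i (Finset.mem_insert_of_mem hi)),
      ih fun i hi => hF i (Finset.mem_insert_of_mem hi)]

theorem contDiffAt_fderiv_apply (hv : ContDiffAt ℝ 3 v x) (e : EuclideanSpace ℝ (Fin d)) :
    ContDiffAt ℝ 2 (fun y => fderiv ℝ v y e) x :=
  (hv.fderiv_right (m := 2) (by norm_num)).clm_apply contDiffAt_const

theorem hessian_symm (hv : ContDiffAt ℝ 2 v x) (X Y : EuclideanSpace ℝ (Fin d)) :
    fderiv ℝ (fderiv ℝ v) x X Y = fderiv ℝ (fderiv ℝ v) x Y X :=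
  (hv.isSymmSndFDerivAt (by simp)) X Y

theorem fderiv_fderiv_apply (hv : ContDiffAt ℝ 2 v x) (e X : EuclideanSpace ℝ (Fin d)) :
    fderiv ℝ (fun y => fderiv ℝ v y e) x X = fderiv ℝ (fderiv ℝ v) x X e := by
  rw [(hasFDerivAt_fderiv_apply hv.differentiableAt_fderiv_real e).fderiv]
  rfl

/-- Directional derivatives of solutions solve the linearised equation. -/
theorem linTr_fderiv_apply (hv : ContDiffAt ℝ 3 v x)
    (hpde : ∀ᶠ y in 𝓝 x, hodTr l (fderiv ℝ v y) (fderiv ℝ (fderiv ℝ v) y) = 0)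
    (e : EuclideanSpace ℝ (Fin d)) : linTr l v (fun y => fderiv ℝ v y e) x = 0 := by
  have hv2 : ∀ᶠ y in 𝓝 x, ContDiffAt ℝ 2 v y :=
    (hv.eventually (by simp)).mono fun y hy => hy.of_le (by norm_num)
  have hg : ContDiffAt ℝ 2 (fderiv ℝ v) x := hv.fderiv_right (m := 2) (by norm_num)
  have hH : ContDiffAt ℝ 1 (fderiv ℝ (fderiv ℝ v)) x := hg.fderiv_right (m := 1) (by norm_num)
  have hHd := hH.differentiableAt (by simp)
  set D3 := fderiv ℝ (fderiv ℝ (fderiv ℝ v)) x with hD3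
  have hsym : ∀ X Y, D3 X Y = D3 Y X := fun X Y => (hg.isSymmSndFDerivAt (by simp)) X Y
  have h1 : fderiv ℝ (fun y => fderiv ℝ v y e) =ᶠ[𝓝 x] fun y => fderiv ℝ (fderiv ℝ v) y e := by
    filter_upwards [hv2] with y hy
    ext X
    rw [fderiv_fderiv_apply hy, hessian_symm hy]
  have h2 : ∀ X Y, fderiv ℝ (fderiv ℝ (fun y => fderiv ℝ v y e)) x X Y = D3 X e Y := by
    intro X Y
    rw [h1.fderiv_eq]
    have := (ContinuousLinearMap.apply ℝ (EuclideanSpace ℝ (Fin d) →L[ℝ] ℝ) e).hasFDerivAt.comp x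
      hHd.hasFDerivAt
    have h3 : HasFDerivAt (fun y => fderiv ℝ (fderiv ℝ v) y e) _ x := this
    rw [h3.fderiv]
    rfl
  have hfr : ∀ m, HasFDerivAt (fun y => frame l m (fderiv ℝ v y))
      ((frameLin l m).comp (fderiv ℝ (fderiv ℝ v) x)) x := fun m => by
    have := ((frameLin l m).hasFDerivAt.comp x (hg.differentiableAt (by simp)).hasFDerivAt).const_add
      (stdE m)
    exact this
  have hF : HasFDerivAt (fun y => hodTr l (fderiv ℝ v y) (fderiv ℝ (fderiv ℝ v) y)) _ x :=
    HasFDerivAt.fun_sum fun m _ => (hHd.hasFDerivAt.clm_apply (hfr m)).clm_apply (hfr m)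
  have h0 : fderiv ℝ (fun y => hodTr l (fderiv ℝ v y) (fderiv ℝ (fderiv ℝ v) y)) x = 0 := by
    have h4 : (fun y => hodTr l (fderiv ℝ v y) (fderiv ℝ (fderiv ℝ v) y)) =ᶠ[𝓝 x] fun _ => 0 := hpde
    rw [h4.fderiv_eq]; simp
  rw [hF.fderiv] at h0
  refine Eq.trans ?_ (DFunLike.congr_fun h0 e)
  rw [linTr]
  simp only [_root_.sum_apply]
  refine Finset.sum_congr rfl fun m _ => ?_
  rw [h2, h1.eq_of_nhds, hsym]
  simp only [add_apply, ContinuousLinearMap.comp_apply, ContinuousLinearMap.flip_apply]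
  rw [hessian_symm (hv.of_le (by norm_num)) (frameLin l m _)]
  ring

end Linearised

/-- The squared norm of the tangential gradient. -/
def tangFn {d : ℕ} (l : Fin d) (v : EuclideanSpace ℝ (Fin d) → ℝ) (y : EuclideanSpace ℝ (Fin d)) : ℝ :=
  ∑ i ∈ Finset.univ.erase l, fderiv ℝ v y (stdE i) * fderiv ℝ v y (stdE i)

/-- The function `√(1 + |∇'v|²)`. -/
def tangLen {d : ℕ} (l : Fin d) (v : EuclideanSpace ℝ (Fin d) → ℝ) (y : EuclideanSpace ℝ (Fin d)) : ℝ :=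
  √(1 + tangFn l v y)

/-- The defect in the oblique boundary condition. -/
def obliq {d : ℕ} (l : Fin d) (v : EuclideanSpace ℝ (Fin d) → ℝ) (y : EuclideanSpace ℝ (Fin d)) : ℝ :=
  (fderiv ℝ v y (stdE l) - tangLen l v y) - (-1)

/-- The auxiliary function in the gradient estimate, comparable to `|∇v|²`. -/
def gradFn {d : ℕ} (l : Fin d) (v : EuclideanSpace ℝ (Fin d) → ℝ) (y : EuclideanSpace ℝ (Fin d)) : ℝ :=
  tangFn l v y + obliq l v y * obliq l v y

section Bernstein

variable {d : ℕ} {l : Fin d} {v f g : EuclideanSpace ℝ (Fin d) → ℝ} {x : EuclideanSpace ℝ (Fin d)}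

theorem tangFn_nonneg : 0 ≤ tangFn l v x := Finset.sum_nonneg fun _ _ => mul_self_nonneg _

theorem tangLen_mul_self : tangLen l v x * tangLen l v x = 1 + tangFn l v x :=
  Real.mul_self_sqrt (by linarith [tangFn_nonneg (l := l) (v := v) (x := x)])

theorem one_le_tangLen : 1 ≤ tangLen l v x :=
  Real.one_le_sqrt.2 (by linarith [tangFn_nonneg (l := l) (v := v) (x := x)])

theorem tangFn_add_sq : tangFn l v x + fderiv ℝ v x (stdE l) ^ 2 = ‖fderiv ℝ v x‖ ^ 2 := by
  rw [← sum_sq_apply_stdE, ← Finset.add_sum_erase _ _ (Finset.mem_univ l), add_comm, tangFn]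
  simp only [sq]

theorem gradFn_nonneg : 0 ≤ gradFn l v x := add_nonneg tangFn_nonneg (mul_self_nonneg _)

theorem gradFn_le (h : ‖fderiv ℝ v x‖ ≤ 1 / 2) : gradFn l v x ≤ 2 * ‖fderiv ℝ v x‖ ^ 2 := by
  have h1 := tangFn_add_sq (l := l) (v := v) (x := x)
  have h2 := tangLen_mul_self (l := l) (v := v) (x := x)
  have h3 := one_le_tangLen (l := l) (v := v) (x := x)
  have h4 := tangFn_nonneg (l := l) (v := v) (x := x)
  have h5 : ‖fderiv ℝ v x‖ ^ 2 ≤ 1 / 4 := by nlinarith [norm_nonneg (fderiv ℝ v x)]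
  rw [gradFn, obliq, ← h1]
  rw [← h1] at h5
  set p := fderiv ℝ v x (stdE l)
  set n := tangLen l v x
  set τ := tangFn l v x
  have h6 : 2 * (n - 1) ≤ τ := by nlinarith
  have h7 : 4 * (n - 1) ^ 2 ≤ τ / 4 := by nlinarith [sq_nonneg p]
  nlinarith [sq_nonneg (p + (n - 1))]

theorem le_gradFn (h : ‖fderiv ℝ v x‖ ≤ 1 / 2) : ‖fderiv ℝ v x‖ ^ 2 ≤ 2 * gradFn l v x := by
  have h1 := tangFn_add_sq (l := l) (v := v) (x := x)
  have h2 := tangLen_mul_self (l := l) (v := v) (x := x)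
  have h3 := one_le_tangLen (l := l) (v := v) (x := x)
  have h4 := tangFn_nonneg (l := l) (v := v) (x := x)
  have h5 : ‖fderiv ℝ v x‖ ^ 2 ≤ 1 / 4 := by nlinarith [norm_nonneg (fderiv ℝ v x)]
  rw [gradFn, obliq, ← h1]
  rw [← h1] at h5
  set p := fderiv ℝ v x (stdE l)
  set n := tangLen l v x
  set τ := tangFn l v x
  have h6 : 2 * (n - 1) ≤ τ := by nlinarith
  have h7 : 4 * (n - 1) ^ 2 ≤ τ / 4 := by nlinarith [sq_nonneg p]
  nlinarith [sq_nonneg (p - 2 * (n - 1))]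

theorem contDiffAt_tangFn (hv : ContDiffAt ℝ 3 v x) : ContDiffAt ℝ 2 (tangFn l v) x :=
  ContDiffAt.sum fun i _ => (contDiffAt_fderiv_apply hv (stdE i)).mul (contDiffAt_fderiv_apply hv (stdE i))

theorem contDiffAt_tangLen (hv : ContDiffAt ℝ 3 v x) : ContDiffAt ℝ 2 (tangLen l v) x :=
  (contDiffAt_const.add (contDiffAt_tangFn hv)).sqrt
    (by linarith [tangFn_nonneg (l := l) (v := v) (x := x)])

theorem contDiffAt_obliq (hv : ContDiffAt ℝ 3 v x) : ContDiffAt ℝ 2 (obliq l v) x :=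
  ((contDiffAt_fderiv_apply hv (stdE l)).sub (contDiffAt_tangLen hv)).sub contDiffAt_const

theorem contDiffAt_gradFn (hv : ContDiffAt ℝ 3 v x) : ContDiffAt ℝ 2 (gradFn l v) x :=
  (contDiffAt_tangFn hv).add ((contDiffAt_obliq hv).mul (contDiffAt_obliq hv))

theorem fderiv_tangFn (hv : ContDiffAt ℝ 3 v x) (X : EuclideanSpace ℝ (Fin d)) :
    fderiv ℝ (tangFn l v) x X
      = 2 * ∑ i ∈ Finset.univ.erase l, fderiv ℝ v x (stdE i) * fderiv ℝ (fderiv ℝ v) x X (stdE i) := by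
  have h := fun i => (contDiffAt_fderiv_apply hv (stdE i)).differentiableAt (by simp)
  have h1 : tangFn l v = fun y => ∑ i ∈ Finset.univ.erase l,
      fderiv ℝ v y (stdE i) * fderiv ℝ v y (stdE i) := rfl
  rw [h1, fderiv_fun_sum fun i _ => (h i).fun_mul (h i), _root_.sum_apply, Finset.mul_sum]
  refine Finset.sum_congr rfl fun i _ => ?_
  rw [fderiv_fun_mul (h i) (h i)]
  simp only [add_apply, smul_apply, smul_eq_mul, fderiv_fderiv_apply (hv.of_le (by norm_num))]
  ring

theorem tangLen_mul_fderiv (hv : ContDiffAt ℝ 3 v x) (X : EuclideanSpace ℝ (Fin d)) :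
    tangLen l v x * fderiv ℝ (tangLen l v) x X
      = ∑ i ∈ Finset.univ.erase l, fderiv ℝ v x (stdE i) * fderiv ℝ (fderiv ℝ v) x X (stdE i) := by
  have h := (contDiffAt_tangLen (l := l) hv).differentiableAt (by simp)
  have h1 : (fun y => tangLen l v y * tangLen l v y) = fun y => 1 + tangFn l v y := by
    ext y; exact tangLen_mul_self
  have h2 := fderiv_fun_mul h h
  rw [h1, fderiv_const_add] at h2
  have h3 := DFunLike.congr_fun h2 X
  rw [fderiv_tangFn hv] at h3
  simp only [add_apply, smul_apply, smul_eq_mul] at h3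
  linarith

theorem fderiv_obliq (hv : ContDiffAt ℝ 3 v x) (X : EuclideanSpace ℝ (Fin d)) :
    fderiv ℝ (obliq l v) x X = fderiv ℝ (fderiv ℝ v) x X (stdE l) - fderiv ℝ (tangLen l v) x X := by
  have h1 : obliq l v = fun y => (fderiv ℝ v y (stdE l) - tangLen l v y) - (-1) := rfl
  rw [h1, fderiv_sub_const, fderiv_fun_sub
    ((contDiffAt_fderiv_apply hv (stdE l)).differentiableAt (by simp))
    ((contDiffAt_tangLen hv).differentiableAt (by simp)), sub_apply,
    fderiv_fderiv_apply (hv.of_le (by norm_num))]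

theorem fderiv_gradFn (hv : ContDiffAt ℝ 3 v x) (X : EuclideanSpace ℝ (Fin d)) :
    fderiv ℝ (gradFn l v) x X
      = 2 * ∑ i ∈ Finset.univ.erase l, fderiv ℝ v x (stdE i) * fderiv ℝ (fderiv ℝ v) x X (stdE i)
        + 2 * (obliq l v x * fderiv ℝ (obliq l v) x X) := by
  have h := (contDiffAt_obliq (l := l) hv).differentiableAt (by simp)
  have h1 : gradFn l v = fun y => tangFn l v y + obliq l v y * obliq l v y := rfl
  rw [h1, fderiv_fun_add ((contDiffAt_tangFn hv).differentiableAt (by simp)) (h.fun_mul h), add_apply,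
    fderiv_tangFn hv, fderiv_fun_mul h h]
  simp only [add_apply, smul_apply, smul_eq_mul]
  ring

set_option maxHeartbeats 1000000 in
/-- The Bochner-type inequalities behind the gradient estimate. -/
theorem exists_bochner (hv : ContDiffAt ℝ 3 v x)
    (hpde : ∀ᶠ y in 𝓝 x, hodTr l (fderiv ℝ v y) (fderiv ℝ (fderiv ℝ v) y) = 0)
    (hg : ‖fderiv ℝ v x‖ ≤ 1 / 2) :
    ∃ Q, 0 ≤ Q ∧ Q ≤ linTr l v (gradFn l v) x ∧
      carre l v (gradFn l v) (gradFn l v) x ≤ 4 * gradFn l v x * Q ∧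
      ∑ m, ‖fderiv ℝ (fderiv ℝ v) x (frame l m (fderiv ℝ v x))‖ ^ 2 ≤ 3 * Q := by
  set H := fderiv ℝ (fderiv ℝ v) x with hH
  set X := fun m => frame l m (fderiv ℝ v x) with hX
  set T := ∑ m, ∑ i ∈ Finset.univ.erase l, H (X m) (stdE i) ^ 2 with hT
  set B := ∑ m, fderiv ℝ (obliq l v) x (X m) ^ 2 with hB
  set Nn := ∑ m, fderiv ℝ (tangLen l v) x (X m) ^ 2 with hNn
  have hB0 : 0 ≤ B := Finset.sum_nonneg fun _ _ => sq_nonneg _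
  have hT0 : 0 ≤ T := Finset.sum_nonneg fun _ _ => Finset.sum_nonneg fun _ _ => sq_nonneg _
  have hN0 : 0 ≤ Nn := Finset.sum_nonneg fun _ _ => sq_nonneg _
  have hn1 := one_le_tangLen (l := l) (v := v) (x := x)
  have hn2 := tangLen_mul_self (l := l) (v := v) (x := x)
  have hτ : tangFn l v x = ∑ i ∈ Finset.univ.erase l, fderiv ℝ v x (stdE i) ^ 2 := by
    simp only [tangFn, sq]
  have hCV := fun i : Fin d => contDiffAt_fderiv_apply hv (stdE i)
  have hlv := fun i : Fin d => linTr_fderiv_apply hv hpde (stdE i)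
  have hCn := contDiffAt_tangLen (l := l) hv
  have hCb := contDiffAt_obliq (l := l) hv
  have hCτ := contDiffAt_tangFn (l := l) hv
  have hNT : Nn ≤ T := by
    refine Finset.sum_le_sum fun m _ => ?_
    have h1 := tangLen_mul_fderiv (l := l) hv (X m)
    have h2 := Finset.sum_mul_sq_le_sq_mul_sq (Finset.univ.erase l) (fun i => fderiv ℝ v x (stdE i))
      fun i => H (X m) (stdE i)
    rw [← h1, ← hτ] at h2
    have h3 : 0 ≤ ∑ i ∈ Finset.univ.erase l, H (X m) (stdE i) ^ 2 :=
      Finset.sum_nonneg fun _ _ => sq_nonneg _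
    have h4 : 0 < tangLen l v x * tangLen l v x := by nlinarith
    have h5 : tangLen l v x * tangLen l v x * fderiv ℝ (tangLen l v) x (X m) ^ 2
        ≤ tangLen l v x * tangLen l v x * ∑ i ∈ Finset.univ.erase l, H (X m) (stdE i) ^ 2 := by
      nlinarith
    exact le_of_mul_le_mul_left h5 h4
  have hLτ : linTr l v (tangFn l v) x = 2 * T := by
    have h1 : tangFn l v = fun y => ∑ i ∈ Finset.univ.erase l,
      fderiv ℝ v y (stdE i) * fderiv ℝ v y (stdE i) := rfl
    rw [h1, linTr_sum _ fun i _ => (hCV i).mul (hCV i), hT, Finset.sum_comm, Finset.mul_sum]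
    refine Finset.sum_congr rfl fun i _ => ?_
    rw [linTr_mul (hCV i) (hCV i), hlv, carre]
    simp only [fderiv_fderiv_apply (hv.of_le (by norm_num : (2 : WithTop ℕ∞) ≤ 3)), sq, ← hH, hX]
    ring
  have hLn : tangLen l v x * linTr l v (tangLen l v) x = T - Nn := by
    have h1 : (fun y => tangLen l v y * tangLen l v y) = fun y => tangFn l v y - (-1) := by
      ext y; rw [tangLen_mul_self]; ring
    have h2 := linTr_mul (l := l) (v := v) hCn hCn
    rw [h1, linTr_sub_const, hLτ, carre] at h2
    simp only [hNn, sq, hX]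
    linarith
  have hLb : linTr l v (obliq l v) x = - linTr l v (tangLen l v) x := by
    have h1 : obliq l v = fun y => (fderiv ℝ v y (stdE l) + (-1) * tangLen l v y) - (-1) := by
      ext y; rw [obliq]; ring
    rw [h1, linTr_sub_const, linTr_add (hCV l) (contDiffAt_const.mul hCn), hlv, linTr_const_mul _ hCn]
    ring
  have hb : obliq l v x ≤ 1 / 2 := by
    have := (abs_le.1 ((fderiv ℝ v x).le_opNorm (stdE l))).2
    simp only [PiLp.norm_single, norm_one, mul_one] at this
    rw [obliq]; linarith
  refine ⟨T + B, add_nonneg hT0 hB0, ?_, ?_, ?_⟩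
  · have h1 : gradFn l v = fun y => tangFn l v y + obliq l v y * obliq l v y := rfl
    rw [h1, linTr_add hCτ (hCb.mul hCb), linTr_mul hCb hCb, hLτ, hLb, carre]
    have h2 : ∑ m, fderiv ℝ (obliq l v) x (frame l m (fderiv ℝ v x)) *
        fderiv ℝ (obliq l v) x (frame l m (fderiv ℝ v x)) = B := by simp only [hB, sq, hX]
    rw [h2]
    set L := linTr l v (tangLen l v) x
    have h3 : 0 ≤ L := by
      by_contra! h; nlinarith
    have h4 : L ≤ T := by nlinarith
    nlinarith
  · rw [carre]
    have h1 : ∀ m, fderiv ℝ (gradFn l v) x (X m) * fderiv ℝ (gradFn l v) x (X m)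
        ≤ 4 * gradFn l v x * (∑ i ∈ Finset.univ.erase l, H (X m) (stdE i) ^ 2
          + fderiv ℝ (obliq l v) x (X m) ^ 2) := by
      intro m
      have h2 := Finset.sum_mul_sq_le_sq_mul_sq (Finset.univ.erase l) (fun i => fderiv ℝ v x (stdE i))
        fun i => H (X m) (stdE i)
      rw [← hτ] at h2
      rw [fderiv_gradFn hv, gradFn]
      have h3 : 0 ≤ ∑ i ∈ Finset.univ.erase l, H (X m) (stdE i) ^ 2 :=
        Finset.sum_nonneg fun _ _ => sq_nonneg _
      have h4 := tangFn_nonneg (l := l) (v := v) (x := x)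
      set s := ∑ i ∈ Finset.univ.erase l, fderiv ℝ v x (stdE i) * H (X m) (stdE i)
      set S := ∑ i ∈ Finset.univ.erase l, H (X m) (stdE i) ^ 2
      set b := obliq l v x
      set b' := fderiv ℝ (obliq l v) x (X m)
      set τ := tangFn l v x
      have h5 : 2 * (s * (b * b')) ≤ τ * b' ^ 2 + b ^ 2 * S := by
        have h6 : (s * (b * b')) ^ 2 ≤ (τ * b' ^ 2) * (b ^ 2 * S) := by
          nlinarith [mul_le_mul_of_nonneg_right h2 (sq_nonneg (b * b'))]
        have h7 : 0 ≤ τ * b' ^ 2 := mul_nonneg h4 (sq_nonneg _)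
        have h8 : 0 ≤ b ^ 2 * S := mul_nonneg (sq_nonneg _) h3
        refine le_of_abs_le (abs_le_of_sq_le_sq ?_ (by linarith))
        nlinarith [sq_nonneg (τ * b' ^ 2 - b ^ 2 * S)]
      nlinarith
    refine (Finset.sum_le_sum fun m _ => h1 m).trans ?_
    rw [← Finset.mul_sum, Finset.sum_add_distrib]
  · have h1 : ∀ m, ‖H (X m)‖ ^ 2 ≤ ∑ i ∈ Finset.univ.erase l, H (X m) (stdE i) ^ 2
        + (2 * fderiv ℝ (obliq l v) x (X m) ^ 2 + 2 * fderiv ℝ (tangLen l v) x (X m) ^ 2) := by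
      intro m
      rw [← sum_sq_apply_stdE, ← Finset.add_sum_erase _ _ (Finset.mem_univ l)]
      have h2 := fderiv_obliq (l := l) hv (X m)
      have h3 : H (X m) (stdE l) = fderiv ℝ (obliq l v) x (X m) + fderiv ℝ (tangLen l v) x (X m) := by
        linarith
      rw [h3]
      nlinarith [sq_nonneg (fderiv ℝ (obliq l v) x (X m) - fderiv ℝ (tangLen l v) x (X m))]
    refine (Finset.sum_le_sum fun m _ => h1 m).trans ?_
    rw [Finset.sum_add_distrib, Finset.sum_add_distrib, ← Finset.mul_sum, ← Finset.mul_sum]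
    linarith

end Bernstein

section GradientEstimate

variable {d : ℕ} {l : Fin d} {v f g : EuclideanSpace ℝ (Fin d) → ℝ} {x : EuclideanSpace ℝ (Fin d)}

theorem norm_frameLin_le (l m : Fin d) (β : EuclideanSpace ℝ (Fin d) →L[ℝ] ℝ) :
    ‖frameLin l m β‖ ^ 2 ≤ ‖β‖ ^ 2 := by
  by_cases h : m = l
  · subst h
    rw [frameLin_self]; simp
  · rw [frameLin_of_ne h, ← sum_sq_apply_stdE, norm_add_sq_real, inner_smul_left, inner_smul_right,
      EuclideanSpace.inner_single_right, norm_smul, norm_smul]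
    simp only [PiLp.single_apply, if_neg (Ne.symm h), PiLp.norm_single, norm_one, mul_one, mul_zero,
      add_zero, Real.norm_eq_abs, sq_abs, map_zero]
    rw [← Finset.add_sum_erase _ _ (Finset.mem_univ l)]
    have := Finset.single_le_sum (f := fun i => β (stdE i) ^ 2) (fun i _ => sq_nonneg _)
      (Finset.mem_erase.2 ⟨h, Finset.mem_univ m⟩)
    linarith

theorem sq_sum_frameLin_le (H : EuclideanSpace ℝ (Fin d) →L[ℝ] EuclideanSpace ℝ (Fin d) →L[ℝ] ℝ)
    (X : Fin d → EuclideanSpace ℝ (Fin d)) (β : EuclideanSpace ℝ (Fin d) →L[ℝ] ℝ) :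
    (∑ m, 2 * H (X m) (frameLin l m β)) ^ 2 ≤ 4 * d * ‖β‖ ^ 2 * ∑ m, ‖H (X m)‖ ^ 2 := by
  have h1 : ∀ m, (2 * H (X m) (frameLin l m β)) ^ 2 ≤ 4 * ‖β‖ ^ 2 * ‖H (X m)‖ ^ 2 := by
    intro m
    have h2 : (H (X m) (frameLin l m β)) ^ 2 ≤ (‖H (X m)‖ * ‖frameLin l m β‖) ^ 2 := by
      rw [← sq_abs]
      exact pow_le_pow_left₀ (abs_nonneg _) ((H (X m)).le_opNorm _) 2
    have h3 := mul_le_mul_of_nonneg_left (norm_frameLin_le l m β) (sq_nonneg ‖H (X m)‖)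
    rw [mul_pow] at h2 ⊢
    linarith
  have h4 := sq_sum_le_card_mul_sum_sq (s := Finset.univ) (f := fun m => 2 * H (X m) (frameLin l m β))
  refine h4.trans ?_
  rw [Finset.card_univ, Fintype.card_fin]
  calc (d : ℝ) * ∑ m, (2 * H (X m) (frameLin l m β)) ^ 2
      ≤ d * ∑ m, 4 * ‖β‖ ^ 2 * ‖H (X m)‖ ^ 2 := by gcongr with m; exact h1 m
    _ = _ := by rw [← Finset.mul_sum]; ring

theorem linTr_eq_add : linTr l v f x = hodTr l (fderiv ℝ v x) (fderiv ℝ (fderiv ℝ f) x)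
    + ∑ m, 2 * fderiv ℝ (fderiv ℝ v) x (frame l m (fderiv ℝ v x)) (frameLin l m (fderiv ℝ f x)) := by
  rw [linTr, hodTr, ← Finset.sum_add_distrib]

theorem carre_sq_le : carre l v f g x ^ 2 ≤ carre l v f f x * carre l v g g x := by
  have := Finset.sum_mul_sq_le_sq_mul_sq Finset.univ
    (fun m => fderiv ℝ f x (frame l m (fderiv ℝ v x))) (fun m => fderiv ℝ g x (frame l m (fderiv ℝ v x)))
  simpa only [carre, sq] using this

theorem neg_add_le_of_sq_le {s a b : ℝ} (ha : 0 ≤ a) (hb : 0 ≤ b) (h : s ^ 2 ≤ 4 * a * b) :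
    -(a + b) ≤ s := by
  refine (abs_le.1 (abs_le_of_sq_le_sq ?_ (by linarith))).1
  nlinarith [sq_nonneg (a - b)]

/-- The arithmetic contradiction at an interior maximum of the auxiliary function. -/
theorem bernstein_arith {D η w Q P M lam R Gη Gv Lη Lw A C u V : ℝ} (hD : 1 ≤ D) (hR : 0 < R)
    (hη : 0 < η) (hηR : η ≤ R) (hw : 0 < w) (hQ : 0 ≤ Q) (hLw : Q ≤ Lw) (hLη : -(6 * D) + Gη ≤ Lη)
    (hGη : Gη ^ 2 ≤ 48 * D * R * Q) (hA : 0 ≤ A) (hC : C ^ 2 ≤ 48 * D * R * w * Q)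
    (hu : u ^ 2 ≤ 4 * M ^ 2) (hGv : Gv ^ 2 ≤ 12 * D * Q * P) (hV : P ≤ 10 * V) (hwP : w ≤ 2 * P)
    (hP : P ≤ 1 / 4) (hlam : lam = 20000 * D * R) (hηM : 1920 * D * lam * M ^ 2 ≤ η ^ 2)
    (h : η * η * Lw + w * (2 * η * Lη + 2 * A) + 2 * (2 * η * C) + lam * (2 * u * Gv + 2 * V) ≤ 0) :
    False := by
  have hP0 : 0 < P := by linarith
  have hD0 : 0 < D := by linarith
  have hlam0 : 0 < lam := by rw [hlam]; positivity
  have ha : 0 ≤ η ^ 2 * Q / 4 := by positivity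
  have h1 : η * η * Q ≤ η * η * Lw := by gcongr
  have h2 : w * (2 * η * (-(6 * D) + Gη)) ≤ w * (2 * η * Lη) := by gcongr
  have h3 : w * (2 * η * (6 * D)) ≤ w * (2 * R * (6 * D)) := by gcongr
  have h4 : -(η ^ 2 * Q / 4 + 192 * D * w ^ 2 * R) ≤ 2 * w * η * Gη := by
    refine neg_add_le_of_sq_le ha (by positivity) ?_
    calc (2 * w * η * Gη) ^ 2 = (2 * w * η) ^ 2 * Gη ^ 2 := by ring
      _ ≤ (2 * w * η) ^ 2 * (48 * D * R * Q) := by gcongr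
      _ = _ := by ring
  have h5 : -(η ^ 2 * Q / 4 + 768 * D * R * w) ≤ 4 * η * C := by
    refine neg_add_le_of_sq_le ha (by positivity) ?_
    calc (4 * η * C) ^ 2 = (4 * η) ^ 2 * C ^ 2 := by ring
      _ ≤ (4 * η) ^ 2 * (48 * D * R * w * Q) := by gcongr
      _ = _ := by ring
  have h6 : -(η ^ 2 * Q / 4 + lam * P / 10) ≤ 2 * lam * u * Gv := by
    refine neg_add_le_of_sq_le ha (by positivity) ?_
    calc (2 * lam * u * Gv) ^ 2 = 4 * lam ^ 2 * (u ^ 2 * Gv ^ 2) := by ring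
      _ ≤ 4 * lam ^ 2 * (4 * M ^ 2 * (12 * D * Q * P)) := by gcongr
      _ = (1920 * D * lam * M ^ 2) * (Q * lam * P / 10) := by ring
      _ ≤ η ^ 2 * (Q * lam * P / 10) := by gcongr
      _ = _ := by ring
  have h7 : lam * P ≤ lam * (10 * V) := by gcongr
  have h8 : D * R * w ^ 2 ≤ D * R * (w * (1 / 2)) := by rw [sq]; gcongr; linarith
  have h9 : D * R * w ≤ D * R * (2 * P) := by gcongr
  have h10 : 0 < D * R * P := by positivity
  have h11 : lam * P = 20000 * (D * R * P) := by rw [hlam]; ring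
  have h12 : 0 ≤ w * A := by positivity
  nlinarith

/-- The auxiliary function in the gradient estimate. -/
def bernFn {d : ℕ} (l : Fin d) (v : EuclideanSpace ℝ (Fin d) → ℝ) (c : EuclideanSpace ℝ (Fin d))
    (R lam M : ℝ) (y : EuclideanSpace ℝ (Fin d)) : ℝ :=
  (((-1) * ‖y - c‖ ^ 2 - (-R)) * ((-1) * ‖y - c‖ ^ 2 - (-R))) * gradFn l v y
    + lam * ((v y - M) * (v y - M))

section Cutoff

variable {c : EuclideanSpace ℝ (Fin d)} {R lam M : ℝ}

theorem contDiffAt_cutoff (c x : EuclideanSpace ℝ (Fin d)) (R : ℝ) :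
    ContDiffAt ℝ 2 (fun y => (-1) * ‖y - c‖ ^ 2 - (-R)) x :=
  (contDiffAt_const.mul (contDiffAt_norm_sub_sq c x 2)).sub contDiffAt_const

theorem fderiv_cutoff (X : EuclideanSpace ℝ (Fin d)) :
    fderiv ℝ (fun y => (-1) * ‖y - c‖ ^ 2 - (-R)) x X = -(2 * inner ℝ (x - c) X) := by
  rw [fderiv_sub_const, fderiv_const_mul ((contDiffAt_norm_sub_sq c x 2).differentiableAt (by simp)),
    smul_apply, fderiv_norm_sub_sq, smul_eq_mul, neg_one_mul]

theorem norm_fderiv_cutoff_le :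
    ‖fderiv ℝ (fun y => (-1) * ‖y - c‖ ^ 2 - (-R)) x‖ ≤ 2 * ‖x - c‖ := by
  refine ContinuousLinearMap.opNorm_le_bound _ (by positivity) fun X => ?_
  rw [fderiv_cutoff, norm_neg, norm_mul, Real.norm_of_nonneg (by norm_num : (0 : ℝ) ≤ 2), mul_assoc]
  gcongr
  exact norm_inner_le_norm _ _

theorem hessian_cutoff (X : EuclideanSpace ℝ (Fin d)) :
    fderiv ℝ (fderiv ℝ (fun y => (-1) * ‖y - c‖ ^ 2 - (-R))) x X X = -(2 * ‖X‖ ^ 2) := by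
  rw [hessian_sub_const, hessian_const_mul _ (contDiffAt_norm_sub_sq c x 2), smul_apply, smul_apply,
    hessian_norm_sub_sq, real_inner_self_eq_norm_sq, smul_eq_mul, neg_one_mul]

theorem contDiffAt_bernFn (hv : ContDiffAt ℝ 3 v x) : ContDiffAt ℝ 2 (bernFn l v c R lam M) x := by
  have h1 := contDiffAt_cutoff c x R
  have h2 : ContDiffAt ℝ 2 (fun y => v y - M) x := (hv.of_le (by norm_num)).sub contDiffAt_const
  exact ((h1.mul h1).mul (contDiffAt_gradFn hv)).add (contDiffAt_const.mul (h2.mul h2))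

theorem bernstein_interior (hv : ContDiffAt ℝ 3 v x)
    (hpde : ∀ᶠ y in 𝓝 x, hodTr l (fderiv ℝ v y) (fderiv ℝ (fderiv ℝ v) y) = 0)
    (hg : ‖fderiv ℝ v x‖ ≤ 1 / 2) (hM : |v x| ≤ M) (hx : ‖x - c‖ ^ 2 < R)
    (hw : 0 < gradFn l v x) (hlam : lam = 20000 * d * R)
    (hηM : 1920 * d * lam * M ^ 2 ≤ (R - ‖x - c‖ ^ 2) ^ 2)
    (h1 : fderiv ℝ (bernFn l v c R lam M) x = 0)
    (h2 : ∀ X, fderiv ℝ (fderiv ℝ (bernFn l v c R lam M)) x X X ≤ 0) : False := by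
  obtain ⟨Q, hQ, hLw, hCw, hS⟩ := exists_bochner hv hpde hg
  have hd : (1 : ℝ) ≤ d := by exact_mod_cast l.pos
  have hR : 0 < R := (sq_nonneg _).trans_lt hx
  set η : EuclideanSpace ℝ (Fin d) → ℝ := fun y => (-1) * ‖y - c‖ ^ 2 - (-R) with hη
  have hCη : ContDiffAt ℝ 2 η x := contDiffAt_cutoff c x R
  have hCg := contDiffAt_gradFn (l := l) hv
  have hv2 : ContDiffAt ℝ 2 v x := hv.of_le (by norm_num)
  have hCv : ContDiffAt ℝ 2 (fun y => v y - M) x := hv2.sub contDiffAt_const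
  have hηx : η x = R - ‖x - c‖ ^ 2 := by simp only [hη]; ring
  have hL : linTr l v (bernFn l v c R lam M) x ≤ 0 := by
    rw [linTr, h1]
    refine Finset.sum_nonpos fun m _ => ?_
    have := h2 (frame l m (fderiv ℝ v x))
    simpa using this
  have hX : ∀ m, ‖frame l m (fderiv ℝ v x)‖ ^ 2 ≤ 3 := fun m => norm_frame_sq_le hg
  have hXs : ∑ m, ‖frame l m (fderiv ℝ v x)‖ ^ 2 ≤ 3 * d := by
    refine (Finset.sum_le_sum fun m _ => hX m).trans ?_
    simp [mul_comm]
  have hsplit : linTr l v (bernFn l v c R lam M) x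
      = η x * η x * linTr l v (gradFn l v) x
        + gradFn l v x * (2 * η x * linTr l v η x + 2 * carre l v η η x)
        + 2 * (2 * η x * carre l v η (gradFn l v) x)
        + lam * (2 * (v x - M) * linTr l v v x + 2 * carre l v v v x) := by
    have e0 : bernFn l v c R lam M = fun y => (η y * η y) * gradFn l v y
      + lam * ((v y - M) * (v y - M)) := rfl
    have e1 : carre l v (fun y => η y * η y) (gradFn l v) x
        = 2 * η x * carre l v η (gradFn l v) x := by
      have hηd := hCη.differentiableAt (by simp)
      simp only [carre, fderiv_fun_mul hηd hηd, add_apply, smul_apply, smul_eq_mul, Finset.mul_sum]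
      exact Finset.sum_congr rfl fun m _ => by ring
    have e2 : carre l v (fun y => v y - M) (fun y => v y - M) x = carre l v v v x := by
      simp only [carre, fderiv_sub_const]
    rw [e0, linTr_add ((hCη.mul hCη).mul hCg) (contDiffAt_const.mul (hCv.mul hCv)),
      linTr_mul (hCη.mul hCη) hCg, linTr_const_mul _ (hCv.mul hCv), linTr_mul hCη hCη,
      linTr_mul hCv hCv, linTr_sub_const (f := v), e1, e2]
    ring
  rw [hsplit] at hL
  have hxR : ‖x - c‖ ^ 2 ≤ R := hx.le
  have hGle : ∀ β : EuclideanSpace ℝ (Fin d) →L[ℝ] ℝ,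
      (∑ m, 2 * fderiv ℝ (fderiv ℝ v) x (frame l m (fderiv ℝ v x)) (frameLin l m β)) ^ 2
        ≤ 12 * d * Q * ‖β‖ ^ 2 := fun β => by
    refine (sq_sum_frameLin_le _ _ β).trans ?_
    have : 4 * d * ‖β‖ ^ 2 * ∑ m, ‖fderiv ℝ (fderiv ℝ v) x (frame l m (fderiv ℝ v x))‖ ^ 2
        ≤ 4 * d * ‖β‖ ^ 2 * (3 * Q) := by gcongr
    linarith
  have hDη : ‖fderiv ℝ η x‖ ^ 2 ≤ 4 * R := by
    have : ‖fderiv ℝ η x‖ ^ 2 ≤ (2 * ‖x - c‖) ^ 2 := by gcongr; exact norm_fderiv_cutoff_le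
    rw [mul_pow] at this
    linarith
  have hcarre : carre l v η η x ≤ 12 * d * R := by
    have : ∀ m, fderiv ℝ η x (frame l m (fderiv ℝ v x)) * fderiv ℝ η x (frame l m (fderiv ℝ v x))
        ≤ 4 * R * ‖frame l m (fderiv ℝ v x)‖ ^ 2 := fun m => by
      rw [← sq, ← sq_abs]
      have := pow_le_pow_left₀ (abs_nonneg _) ((fderiv ℝ η x).le_opNorm (frame l m (fderiv ℝ v x))) 2
      rw [Real.norm_eq_abs, mul_pow] at this
      exact this.trans (by gcongr)
    refine (Finset.sum_le_sum fun m _ => this m).trans ?_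
    rw [← Finset.mul_sum]
    nlinarith
  have hP : ‖fderiv ℝ v x‖ ^ 2 ≤ 1 / 4 := by nlinarith [norm_nonneg (fderiv ℝ v x)]
  have hcc : 0 ≤ carre l v η η x := Finset.sum_nonneg fun _ _ => mul_self_nonneg _
  have hcw : 0 ≤ carre l v (gradFn l v) (gradFn l v) x := Finset.sum_nonneg fun _ _ => mul_self_nonneg _
  refine bernstein_arith (D := d) (η := η x) (w := gradFn l v x) (Q := Q) (P := ‖fderiv ℝ v x‖ ^ 2)
    (M := M) (R := R) (u := v x - M) (V := carre l v v v x) hd hR (by rw [hηx]; linarith)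
    (by rw [hηx]; linarith [sq_nonneg ‖x - c‖]) hw hQ hLw (Lη := linTr l v η x)
    (Gη := ∑ m, 2 * fderiv ℝ (fderiv ℝ v) x (frame l m (fderiv ℝ v x)) (frameLin l m (fderiv ℝ η x)))
    ?_ ?_ hcc (C := carre l v η (gradFn l v) x) ?_ ?_ (Gv := linTr l v v x) ?_ ?_ (gradFn_le hg) hP hlam
    (by rw [hηx]; exact hηM) hL
  · rw [linTr_eq_add, hodTr]
    refine add_le_add ?_ le_rfl
    simp only [hη, hessian_cutoff]
    rw [Finset.sum_neg_distrib, ← Finset.mul_sum]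
    linarith
  · refine (hGle _).trans ?_
    have : 12 * d * Q * ‖fderiv ℝ η x‖ ^ 2 ≤ 12 * d * Q * (4 * R) := by gcongr
    linarith
  · refine carre_sq_le.trans ((mul_le_mul hcarre hCw hcw (by positivity)).trans_eq ?_)
    ring
  · have h3 := abs_le.1 hM
    nlinarith
  · rw [linTr_eq_add, hpde.self_of_nhds, zero_add]
    exact hGle _
  · set q := (InnerProductSpace.toDual ℝ (EuclideanSpace ℝ (Fin d))).symm (fderiv ℝ v x) with hq
    have e1 : ∀ X, fderiv ℝ v x X = inner ℝ q X := fun X => by simp [hq]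
    have e2 : ‖fderiv ℝ v x‖ = ‖q‖ := by simp [hq]
    rw [e2]
    refine (norm_sq_le_sum_inner_frame hg q l).trans_eq ?_
    simp only [carre, e1, sq]

end Cutoff

end GradientEstimate

section GradientEstimateFlat

variable {d : ℕ} {l : Fin d} {v : EuclideanSpace ℝ (Fin d) → ℝ} {x c : EuclideanSpace ℝ (Fin d)}
  {lam M : ℝ}

set_option maxHeartbeats 1000000 in
theorem bernstein_flat {h : ℝ} (hh : 0 < h) (hc : h ≤ c l) (hlam : 0 ≤ lam) (hv : ContDiffAt ℝ 3 v x)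
    (hg : ‖fderiv ℝ v x‖ ≤ 1 / 2) (hM : |v x| ≤ M) (hxl : x l = 0) (hx : ‖x - c‖ < 2 * h)
    (hw : 0 < gradFn l v x)
    (hob : ∀ᶠ y in 𝓝 x, y l = 0 → obliq l v y = 0)
    (h1 : ∀ X : EuclideanSpace ℝ (Fin d), 0 ≤ X l →
      fderiv ℝ (bernFn l v c ((2 * h) ^ 2) lam M) x X ≤ 0) : False := by
  set n := tangLen l v x with hn
  set p : Fin d → ℝ := fun i => fderiv ℝ v x (stdE i) with hp
  have hn1 : 1 ≤ n := one_le_tangLen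
  have hn2 : n * n = 1 + tangFn l v x := tangLen_mul_self
  have hob0 : obliq l v x = 0 := hob.self_of_nhds hxl
  have hCob := (contDiffAt_obliq (l := l) hv).differentiableAt (by simp)
  have htan : ∀ i ∈ Finset.univ.erase l, fderiv ℝ (obliq l v) x (stdE i) = 0 := by
    intro i hi
    have hil : l ≠ i := (Finset.ne_of_mem_erase hi).symm
    have e1 := fderiv_along_line (f := obliq l v) (x := x) (X := stdE i) (t := 0) (by simpa using hCob)
    have hline : Tendsto (fun s : ℝ => x + s • stdE i) (𝓝 0) (𝓝 x) := by
      have : Continuous (fun s : ℝ => x + s • (stdE i : EuclideanSpace ℝ (Fin d))) := by fun_prop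
      simpa using this.tendsto 0
    have e2 : (fun s : ℝ => obliq l v (x + s • stdE i)) =ᶠ[𝓝 0] fun _ => 0 := by
      filter_upwards [hline.eventually hob] with s hs
      exact hs (by simp [hxl, hil])
    have e3 := (e1.congr_of_eventuallyEq e2.symm).unique (hasDerivAt_const (0 : ℝ) (0 : ℝ))
    simpa using e3
  set H := fderiv ℝ (fderiv ℝ v) x with hH
  set Z : EuclideanSpace ℝ (Fin d) := ∑ j ∈ Finset.univ.erase l, p j • stdE j with hZ
  set Y : EuclideanSpace ℝ (Fin d) := stdE l - n⁻¹ • Z with hY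
  have hn0 : 0 < n := by linarith
  have hZl : Z l = 0 := by
    simp only [hZ, WithLp.ofLp_sum, Finset.sum_apply, PiLp.smul_apply, smul_eq_mul]
    refine Finset.sum_eq_zero fun j hj => ?_
    simp [(Finset.ne_of_mem_erase hj).symm]
  have hYl : Y l = 1 := by simp [hY, hZl]
  have hsym : ∀ X W, H X W = H W X := hessian_symm (hv.of_le (by norm_num))
  have hHY : ∀ i ∈ Finset.univ.erase l, H Y (stdE i) = 0 := by
    intro i hi
    have e1 := fderiv_obliq (l := l) hv (stdE i)
    have e2 := tangLen_mul_fderiv (l := l) hv (stdE i)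
    rw [htan i hi] at e1
    have e3 : H (stdE i) Z = n * fderiv ℝ (tangLen l v) x (stdE i) := by
      rw [e2, hZ, map_sum]
      simp only [map_smul, smul_eq_mul, hp, hH]
    rw [hsym, hY, map_sub, map_smul, e3, smul_eq_mul, inv_mul_cancel_left₀ hn0.ne']
    linarith
  have hwY : fderiv ℝ (gradFn l v) x Y = 0 := by
    rw [fderiv_gradFn hv, hob0, Finset.sum_eq_zero fun i hi => ?_]
    · ring
    · rw [hHY i hi, mul_zero]
  have hτ : tangFn l v x = ∑ i ∈ Finset.univ.erase l, p i ^ 2 := by simp only [tangFn, hp, sq]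
  have hpl : p l = n - 1 := by
    have : (p l - n) - (-1) = 0 := hob0
    linarith
  have hvZ : fderiv ℝ v x Z = tangFn l v x := by
    rw [hZ, map_sum, hτ]
    simp only [map_smul, smul_eq_mul, hp, sq]
  have hvY : fderiv ℝ v x Y ≤ 0 := by
    rw [hY, map_sub, map_smul, hvZ, smul_eq_mul]
    change p l - n⁻¹ * tangFn l v x ≤ 0
    have e1 : tangFn l v x = n * n - 1 := by linarith
    have e2 : n⁻¹ * (n * n - 1) = n - n⁻¹ := by field_simp
    have e3 : n⁻¹ ≤ 1 := inv_le_one_of_one_le₀ hn1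
    rw [hpl, e1, e2]
    linarith
  have hτ4 : tangFn l v x ≤ 1 / 4 := by
    have := tangFn_add_sq (l := l) (v := v) (x := x)
    nlinarith [norm_nonneg (fderiv ℝ v x), sq_nonneg (fderiv ℝ v x (stdE l))]
  have hin : inner ℝ (x - c) Y < 0 := by
    have e1 : inner ℝ (x - c) Z = ∑ j ∈ Finset.univ.erase l, p j * (x - c) j := by
      rw [hZ, inner_sum]
      refine Finset.sum_congr rfl fun j _ => ?_
      rw [inner_smul_right, EuclideanSpace.inner_single_right]
      simp
    have e2 := Finset.sum_mul_sq_le_sq_mul_sq (Finset.univ.erase l) p fun j => (x - c) j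
    rw [← e1, ← hτ] at e2
    have e3 : ‖x - c‖ ^ 2 = (x - c) l ^ 2 + ∑ j ∈ Finset.univ.erase l, (x - c) j ^ 2 := by
      rw [EuclideanSpace.norm_sq_eq, Finset.add_sum_erase _ (fun j => (x - c) j ^ 2) (Finset.mem_univ l)]
      simp
    have e4 : (x - c) l = - c l := by simp [hxl]
    rw [e4] at e3
    have e5 : ‖x - c‖ ^ 2 ≤ (2 * h) ^ 2 := by gcongr
    have e6 : ∑ j ∈ Finset.univ.erase l, (x - c) j ^ 2 ≤ 3 * h ^ 2 := by nlinarith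
    have e7 : inner ℝ (x - c) Z ^ 2 ≤ 1 / 4 * (3 * h ^ 2) :=
      e2.trans (mul_le_mul hτ4 e6 (Finset.sum_nonneg fun _ _ => sq_nonneg _) (by norm_num))
    have e8 : |inner ℝ (x - c) Z| < h := by
      refine abs_lt_of_sq_lt_sq ?_ hh.le
      nlinarith
    have e9 : n⁻¹ ≤ 1 := inv_le_one_of_one_le₀ hn1
    have e10 : 0 < n⁻¹ := inv_pos.2 hn0
    rw [hY, inner_sub_right, inner_smul_right, EuclideanSpace.inner_single_right, e4]
    simp only [one_mul, map_neg, conj_trivial]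
    have e11 := (abs_lt.1 e8).1
    nlinarith
  have hφ := h1 Y (by rw [hYl]; norm_num)
  have hCη := (contDiffAt_cutoff c x ((2 * h) ^ 2)).differentiableAt (by simp)
  have hCg := (contDiffAt_gradFn (l := l) hv).differentiableAt (by simp)
  have hCv : DifferentiableAt ℝ (fun y => v y - M) x :=
    (hv.differentiableAt (by simp)).sub_const M
  have hηx : 0 < (-1) * ‖x - c‖ ^ 2 - (-(2 * h) ^ 2) := by
    have : ‖x - c‖ ^ 2 < (2 * h) ^ 2 := by gcongr
    linarith
  set η : EuclideanSpace ℝ (Fin d) → ℝ := fun y => (-1) * ‖y - c‖ ^ 2 - (-(2 * h) ^ 2) with hη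
  have hηY : fderiv ℝ η x Y = -(2 * inner ℝ (x - c) Y) := fderiv_cutoff Y
  have hDv : fderiv ℝ (fun y => v y - M) x = fderiv ℝ v x := fderiv_sub_const M
  have e0 : bernFn l v c ((2 * h) ^ 2) lam M = fun y => (η y * η y) * gradFn l v y
      + lam * ((v y - M) * (v y - M)) := rfl
  rw [e0, fderiv_fun_add ((hCη.fun_mul hCη).fun_mul hCg) ((hCv.fun_mul hCv).const_mul lam),
    fderiv_fun_mul (hCη.fun_mul hCη) hCg, fderiv_const_mul (hCv.fun_mul hCv), fderiv_fun_mul hCη hCη,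
    fderiv_fun_mul hCv hCv, hDv] at hφ
  simp only [add_apply, smul_apply, smul_eq_mul, hwY, hηY, mul_zero, zero_add] at hφ
  have h3 : 0 < gradFn l v x * (η x * (-inner ℝ (x - c) Y)) :=
    mul_pos hw (mul_pos hηx (by linarith))
  have h4 : 0 ≤ lam * ((M - v x) * (-fderiv ℝ v x Y)) :=
    mul_nonneg hlam (mul_nonneg (by linarith [(abs_le.1 hM).2]) (by linarith))
  nlinarith

/-- The interior-and-boundary gradient estimate. -/
theorem hod_gradient_estimate {h : ℝ} (hh : 0 < h) (hc : h ≤ c l) (hM0 : 0 < M)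
    (hv : ∀ y, 0 ≤ y l → ‖y - c‖ ≤ 2 * h → ContDiffAt ℝ 3 v y)
    (hg : ∀ y, 0 ≤ y l → ‖y - c‖ ≤ 2 * h → ‖fderiv ℝ v y‖ ≤ 1 / 2)
    (hM : ∀ y, 0 ≤ y l → ‖y - c‖ ≤ 2 * h → |v y| ≤ M)
    (hpde : ∀ y, 0 < y l → ‖y - c‖ ≤ 2 * h →
      hodTr l (fderiv ℝ v y) (fderiv ℝ (fderiv ℝ v) y) = 0)
    (hob : ∀ y, y l = 0 → ‖y - c‖ ≤ 2 * h → obliq l v y = 0)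
    {y : EuclideanSpace ℝ (Fin d)} (hyl : 0 ≤ y l) (hy : ‖y - c‖ = h) :
    ‖fderiv ℝ v y‖ * h ≤ 5000 * d * M := by
  have hd : (1 : ℝ) ≤ d := by exact_mod_cast l.pos
  set R : ℝ := (2 * h) ^ 2 with hR
  set lam : ℝ := 20000 * d * R with hlam
  have hR0 : 0 < R := by positivity
  have hlam0 : 0 < lam := by positivity
  set K := {y : EuclideanSpace ℝ (Fin d) | 0 ≤ y l ∧ 0 ≤ ‖y - c‖ ∧ ‖y - c‖ ≤ 2 * h} with hK
  set Γ := {y : EuclideanSpace ℝ (Fin d) | ‖y - c‖ = 2 * h} with hΓ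
  have hnhd : ∀ x ∈ K, x ∉ Γ → ∀ᶠ z in 𝓝 x, ‖z - c‖ ≤ 2 * h := by
    intro x hx hG
    have hcont : ContinuousAt (fun y => ‖y - c‖) x := by fun_prop
    filter_upwards [hcont.eventually (gt_mem_nhds (lt_of_le_of_ne hx.2.2 hG))] with z hz
    exact hz.le
  have hyK : y ∈ K := ⟨hyl, norm_nonneg _, by linarith⟩
  obtain ⟨x, hxK, hmax, hcase⟩ := exists_isMaxOn_halfSpace l (K := K) (Γ := Γ)
    (isCompact_annulus l c 0 (2 * h)) ⟨y, hyK⟩ (fun x hx => hx.1)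
    (fun x hx hG => (hnhd x hx hG).mono fun z hz h0 => ⟨h0, norm_nonneg _, hz⟩)
    (φ := bernFn l v c R lam M) (fun x hx => contDiffAt_bernFn (hv x hx.1 hx.2.2))
  have hvx := abs_le.1 (hM x hxK.1 hxK.2.2)
  have hvM : (v x - M) * (v x - M) ≤ 4 * M ^ 2 := by nlinarith
  have hsmall : (R - ‖x - c‖ ^ 2) ^ 2 * gradFn l v x ≤ 960 * d * lam * M ^ 2 →
      bernFn l v c R lam M x ≤ 964 * d * lam * M ^ 2 := by
    intro h0
    have e1 : lam * ((v x - M) * (v x - M)) ≤ lam * (4 * M ^ 2) := by gcongr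
    have e2 : 1 * (lam * M ^ 2) ≤ d * (lam * M ^ 2) := by gcongr
    have e3 : bernFn l v c R lam M x = (R - ‖x - c‖ ^ 2) ^ 2 * gradFn l v x
        + lam * ((v x - M) * (v x - M)) := by rw [bernFn]; ring
    rw [e3]
    linarith
  have hgw : gradFn l v x ≤ 1 / 2 := by
    have := gradFn_le (l := l) (hg x hxK.1 hxK.2.2)
    nlinarith [norm_nonneg (fderiv ℝ v x), hg x hxK.1 hxK.2.2]
  have hpos : 0 < 960 * d * lam * M ^ 2 := by positivity
  have hbound : bernFn l v c R lam M x ≤ 964 * d * lam * M ^ 2 := by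
    refine hsmall ?_
    by_contra! hlt
    have hw : 0 < gradFn l v x := by
      refine lt_of_le_of_ne gradFn_nonneg fun h0 => ?_
      rw [← h0, mul_zero] at hlt
      linarith
    have hsq : 1920 * d * lam * M ^ 2 ≤ (R - ‖x - c‖ ^ 2) ^ 2 := by
      nlinarith [mul_le_mul_of_nonneg_left hgw (sq_nonneg (R - ‖x - c‖ ^ 2))]
    rcases hcase with hG | ⟨hG, hxl, hd1, hd2⟩ | ⟨hG, hxl, hd1⟩
    · have : ‖x - c‖ = 2 * h := hG
      rw [this, ← hR, sub_self] at hlt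
      linarith
    · have hlt2 : ‖x - c‖ < 2 * h := lt_of_le_of_ne hxK.2.2 hG
      refine bernstein_interior (hv x hxK.1 hxK.2.2) ?_ (hg x hxK.1 hxK.2.2) (hM x hxK.1 hxK.2.2)
        ?_ hw hlam hsq hd1 hd2
      · have hcont : ContinuousAt (fun y : EuclideanSpace ℝ (Fin d) => y l) x := by fun_prop
        filter_upwards [hnhd x hxK hG, hcont.eventually (lt_mem_nhds hxl)] with z h1 h2
        exact hpde z h2 h1
      · rw [hR]; gcongr
    · have hlt2 : ‖x - c‖ < 2 * h := lt_of_le_of_ne hxK.2.2 hG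
      refine bernstein_flat hh hc hlam0.le (hv x hxK.1 hxK.2.2) (hg x hxK.1 hxK.2.2)
        (hM x hxK.1 hxK.2.2) hxl hlt2 hw ?_ hd1
      filter_upwards [hnhd x hxK hG] with z h1 h2
      exact hob z h2 h1
  have hfin := (hmax y hyK).trans hbound
  have e3 : bernFn l v c R lam M y = (R - ‖y - c‖ ^ 2) ^ 2 * gradFn l v y
      + lam * ((v y - M) * (v y - M)) := by rw [bernFn]; ring
  rw [e3, hy] at hfin
  have e4 : 0 ≤ lam * ((v y - M) * (v y - M)) := mul_nonneg hlam0.le (mul_self_nonneg _)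
  have e5 := le_gradFn (l := l) (hg y hyl (by linarith))
  have e6 : 9 * h ^ 4 * gradFn l v y ≤ 964 * d * (20000 * d * (2 * h) ^ 2) * M ^ 2 := by
    have : (R - h ^ 2) ^ 2 = 9 * h ^ 4 := by rw [hR]; ring
    rw [this, hlam, hR] at hfin
    rw [hlam, hR] at e4
    linarith
  have e7 : h ^ 2 * (9 * (h ^ 2 * gradFn l v y)) ≤ h ^ 2 * (77120000 * d ^ 2 * M ^ 2) := by
    linarith
  have e8 := le_of_mul_le_mul_left e7 (by positivity)
  refine le_of_abs_le (abs_le_of_sq_le_sq ?_ (by positivity))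
  have e9 : h ^ 2 * ‖fderiv ℝ v y‖ ^ 2 ≤ h ^ 2 * (2 * gradFn l v y) := by gcongr
  have e10 : 0 ≤ (d : ℝ) ^ 2 * M ^ 2 := by positivity
  nlinarith

end GradientEstimateFlat

section Limit

variable {d : ℕ} {l : Fin d} {v : EuclideanSpace ℝ (Fin d) → ℝ}

theorem eventually_far {P : EuclideanSpace ℝ (Fin d) → Prop} :
    (∀ᶠ x in comap (fun y : EuclideanSpace ℝ (Fin d) => ‖y‖) atTop ⊓ 𝓟 {y | 0 ≤ y l ∧ 1 ≤ ‖y‖}, P x) ↔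
      ∃ R, 1 ≤ R ∧ ∀ x, 0 ≤ x l → R ≤ ‖x‖ → P x := by
  rw [eventually_inf_principal, eventually_comap, eventually_atTop]
  constructor
  · rintro ⟨R, h⟩
    exact ⟨max 1 R, le_max_left _ _, fun x hx hR =>
      h ‖x‖ ((le_max_right _ _).trans hR) x rfl ⟨hx, (le_max_left _ _).trans hR⟩⟩
  · rintro ⟨R, -, h⟩
    exact ⟨R, fun r hr x hx hx1 => h x hx1.1 (hr.trans hx.ge)⟩

theorem frequently_far {P : EuclideanSpace ℝ (Fin d) → Prop} :
    (∃ᶠ x in comap (fun y : EuclideanSpace ℝ (Fin d) => ‖y‖) atTop ⊓ 𝓟 {y | 0 ≤ y l ∧ 1 ≤ ‖y‖}, P x) ↔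
      ∀ R, 1 ≤ R → ∃ x, 0 ≤ x l ∧ R ≤ ‖x‖ ∧ P x := by
  rw [Filter.Frequently, eventually_far]
  push Not
  rfl

/-- Bounded solutions whose gradient decays like `1 / |y|` have a limit at infinity. -/
theorem exists_tendsto_far {M C : ℝ} (hC : 0 < C) (hM : ∀ x, 0 ≤ x l → 1 ≤ ‖x‖ → |v x| ≤ M)
    (hz : ∀ x, 0 ≤ x l → 1 ≤ ‖x‖ → IsHodMin l v x)
    (hgr : ∀ x, 0 ≤ x l → 4 ≤ ‖x‖ → ‖fderiv ℝ v x‖ * ‖x‖ ≤ C) :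
    ∃ L, Tendsto v
      (comap (fun y : EuclideanSpace ℝ (Fin d) => ‖y‖) atTop ⊓ 𝓟 {y | 0 ≤ y l ∧ 1 ≤ ‖y‖}) (𝓝 L) := by
  set F := comap (fun y : EuclideanSpace ℝ (Fin d) => ‖y‖) atTop ⊓ 𝓟 {y | 0 ≤ y l ∧ 1 ≤ ‖y‖} with hF
  have hFne : F.NeBot := by
    rw [← frequently_true_iff_neBot, frequently_far]
    intro R hR
    refine ⟨R • stdE l, ?_, ?_, trivial⟩
    · simp; linarith
    · rw [norm_smul]
      simp
      exact le_abs_self R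
  have hub : F.IsBoundedUnder (· ≤ ·) v := ⟨M, eventually_map.2 <|
    eventually_far.2 ⟨1, le_rfl, fun x h1 h2 => (abs_le.1 (hM x h1 h2)).2⟩⟩
  have hlb : F.IsBoundedUnder (· ≥ ·) v := ⟨-M, eventually_map.2 <|
    eventually_far.2 ⟨1, le_rfl, fun x h1 h2 => (abs_le.1 (hM x h1 h2)).1⟩⟩
  refine ⟨liminf v F, tendsto_of_le_liminf_of_limsup_le le_rfl ?_ hub hlb⟩
  by_contra! hlt
  set a := liminf v F
  set b := limsup v F
  set c := (b - a) / 2 with hc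
  have hc0 : 0 < c := by linarith
  set θ := min (1 / 8) (c / (8 * C)) with hθ
  have hθ0 : 0 < θ := by positivity
  have hθ1 : θ ≤ 1 / 8 := min_le_left _ _
  have hθ2 : θ * (8 * C) ≤ c := by
    rw [← le_div_iff₀ (by positivity)]
    exact min_le_right _ _
  obtain ⟨n, hn⟩ := exists_nat_ge (2 / θ)
  have hn0 : 0 < n := by
    have : 0 < (n : ℝ) := lt_of_lt_of_le (by positivity) hn
    exact_mod_cast this
  rw [div_le_iff₀ hθ0] at hn
  set κ := hodGain d ^ (3 * n) * c with hκ
  have hκ0 : 0 < κ := mul_pos (pow_pos (hodGain_pos l.pos) _) hc0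
  obtain ⟨R₁, hR₁, hlow⟩ := eventually_far.1 <|
    eventually_lt_of_lt_liminf (show a - κ / 2 < liminf v F by linarith) hlb
  have key : ∀ R₀, 1 ≤ R₀ → ∃ R, R₀ ≤ R ∧ ∀ y, 0 ≤ y l → ‖y‖ = R → a + κ / 2 ≤ v y := by
    intro R₀ hR₀
    obtain ⟨y₀, hy₀, hy₀R, hvy₀⟩ := frequently_far.1
      (frequently_lt_of_lt_limsup (h := show b - c / 2 < limsup v F by linarith) hlb.isCoboundedUnder_le)
      (R₀ + (2 * R₁ + (c / θ + 8))) (by linarith [show 0 ≤ c / θ by positivity])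
    have hcθ : 0 ≤ c / θ := by positivity
    refine ⟨‖y₀‖, by linarith, fun y₁ hy₁ hy₁R => ?_⟩
    have hnear : ∀ x, 0 ≤ x l → ‖x - y₀‖ ≤ 2 * (θ * ‖y₀‖) → c ≤ v x - (a - κ / 2) := by
      intro x hx hxy
      have hS : Convex ℝ ({x | 0 ≤ x l} ∩ Metric.closedBall y₀ (2 * (θ * ‖y₀‖))) := by
        refine Convex.inter ?_ (convex_closedBall _ _)
        intro p hp q hq s t hs ht _
        simp only [mem_ofPred_eq, PiLp.add_apply, PiLp.smul_apply, smul_eq_mul] at hp hq ⊢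
        positivity
      have hSn : ∀ y ∈ {x | 0 ≤ x l} ∩ Metric.closedBall y₀ (2 * (θ * ‖y₀‖)), 3 / 4 * ‖y₀‖ ≤ ‖y‖ := by
        rintro y ⟨-, hy⟩
        rw [mem_closedBall_iff_norm] at hy
        have e1 := norm_sub_norm_le y₀ y
        rw [norm_sub_rev] at e1
        nlinarith [norm_nonneg y₀]
      have hmv := hS.norm_image_sub_le_of_norm_fderiv_le (𝕜 := ℝ) (f := v) (C := C / (3 / 4 * ‖y₀‖))
        (x := y₀) (y := x)
        (fun y hy => (hz y hy.1 (by linarith [hSn y hy])).1.differentiableAt (by simp))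
        (fun y hy => by
          have e1 := hSn y hy
          rw [le_div_iff₀ (by linarith)]
          exact (mul_le_mul_of_nonneg_left e1 (norm_nonneg _)).trans (hgr y hy.1 (by linarith)))
        ⟨hy₀, Metric.mem_closedBall_self (by positivity)⟩ ⟨hx, mem_closedBall_iff_norm.2 hxy⟩
      have e2 : C / (3 / 4 * ‖y₀‖) * ‖x - y₀‖ ≤ c / 2 := by
        have e3 : 0 < ‖y₀‖ := by linarith
        calc C / (3 / 4 * ‖y₀‖) * ‖x - y₀‖ ≤ C / (3 / 4 * ‖y₀‖) * (2 * (θ * ‖y₀‖)) := by gcongr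
          _ = θ * (8 * C) / 3 := by field_simp; ring
          _ ≤ c / 2 := by linarith
      have e4 := neg_abs_le (v x - v y₀)
      rw [Real.norm_eq_abs] at hmv
      linarith
    have hρ : 0 < θ * ‖y₀‖ := mul_pos hθ0 (by linarith)
    have := hod_harnack (l := l) (z := fun y => v y - (a - κ / 2)) (c := c) hn0 hρ hc0
      (by rw [← div_le_iff₀' hθ0]; linarith)
      (by nlinarith [norm_nonneg y₀]) (by nlinarith [norm_nonneg y₀])
      (fun x h1 h2 => (hz x h1 (by linarith)).sub_const _)
      (fun x h1 h2 => by linarith [hlow x h1 (by linarith)])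
      hy₀ hy₁ rfl hy₁R hnear
    linarith
  obtain ⟨R, hR, hvR⟩ := key 1 le_rfl
  obtain ⟨x, hx, hxR, hvx⟩ := frequently_far.1
    (frequently_lt_of_liminf_lt (h := show liminf v F < a + κ / 2 by linarith) hub.isCoboundedUnder_ge) R hR
  obtain ⟨R', hR', hvR'⟩ := key ‖x‖ (hR.trans hxR)
  exact hvx.not_ge <| hod_min_principle (fun y h1 h2 _ => hz y h1 (hR.trans h2)) hvR hvR' hx hxR hR'

/-- A lower bound on the unit half sphere and on the limit propagates to the exterior domain. -/
theorem le_of_tendsto_far {a L : ℝ} (hz : ∀ x, 0 ≤ x l → 1 ≤ ‖x‖ → IsHodMin l v x)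
    (hL : Tendsto v
      (comap (fun y : EuclideanSpace ℝ (Fin d) => ‖y‖) atTop ⊓ 𝓟 {y | 0 ≤ y l ∧ 1 ≤ ‖y‖}) (𝓝 L))
    (haL : a ≤ L) (ha : ∀ x, 0 ≤ x l → ‖x‖ = 1 → a ≤ v x)
    {x : EuclideanSpace ℝ (Fin d)} (hx : 0 ≤ x l) (hx1 : 1 ≤ ‖x‖) : a ≤ v x := by
  refine le_of_forall_pos_sub_le fun ε hε => ?_
  obtain ⟨R, hR, h⟩ := eventually_far.1 (hL.eventually_const_lt (show a - ε < L by linarith))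
  exact hod_min_principle (r₂ := max R ‖x‖) (fun y h1 h2 _ => hz y h1 h2)
    (fun y h1 h2 => by linarith [ha y h1 h2])
    (fun y h1 h2 => (h y h1 ((le_max_left _ _).trans h2.ge)).le) hx hx1 (le_max_right _ _)

/-- Decay of the gradient of bounded solutions in the exterior domain. -/
theorem norm_fderiv_mul_norm_le {M : ℝ} (hM0 : 0 < M)
    (hv : ∀ y, 0 ≤ y l → 1 ≤ ‖y‖ → ContDiffAt ℝ 3 v y)
    (hg : ∀ y, 0 ≤ y l → 1 ≤ ‖y‖ → ‖fderiv ℝ v y‖ ≤ 1 / 2)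
    (hM : ∀ y, 0 ≤ y l → 1 ≤ ‖y‖ → |v y| ≤ M)
    (hpde : ∀ y, 0 < y l → 1 ≤ ‖y‖ → hodTr l (fderiv ℝ v y) (fderiv ℝ (fderiv ℝ v) y) = 0)
    (hob : ∀ y, y l = 0 → 1 ≤ ‖y‖ → obliq l v y = 0)
    {y : EuclideanSpace ℝ (Fin d)} (hyl : 0 ≤ y l) (hy : 4 ≤ ‖y‖) :
    ‖fderiv ℝ v y‖ * ‖y‖ ≤ 40000 * d * M := by
  have hh : 0 < ‖y‖ / 8 := by linarith
  have hball : ∀ x, ‖x - (y + (‖y‖ / 8) • stdE l)‖ ≤ 2 * (‖y‖ / 8) → 1 ≤ ‖x‖ := by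
    intro x hx
    have e1 := norm_le_norm_add_smul_stdE hyl hh.le
    have e2 := norm_sub_norm_le (y + (‖y‖ / 8) • stdE l) x
    rw [norm_sub_rev] at e2
    linarith
  have := hod_gradient_estimate (c := y + (‖y‖ / 8) • stdE l) hh (by simp [hyl]) hM0
    (fun x h1 h2 => hv x h1 (hball x h2)) (fun x h1 h2 => hg x h1 (hball x h2))
    (fun x h1 h2 => hM x h1 (hball x h2)) (fun x h1 h2 => hpde x h1 (hball x h2))
    (fun x h1 h2 => hob x h1 (hball x h2)) hyl (by simp [norm_smul])
  linarith

end Limit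

section Solution

variable {d : ℕ} {hd : 0 < d} {v : EuclideanSpace ℝ (Fin d) → ℝ} {U : Set (EuclideanSpace ℝ (Fin d))}
  {y : EuclideanSpace ℝ (Fin d)}

theorem IsHodSol.contDiffAt (hv : IsHodSol d hd v U) (hy : y ∈ U) : ContDiffAt ℝ 3 v y := by
  obtain ⟨W, hW, hUW, h⟩ := hv.1
  exact (h.contDiffAt (hW.mem_nhds (hUW hy))).of_le
    (WithTop.coe_le_coe.2 le_top : ((3 : ℕ∞) : WithTop ℕ∞) ≤ ∞)

theorem IsHodSol.hodTr_eq_zero (hv : IsHodSol d hd v U) (hy : y ∈ U) (hg : ‖fderiv ℝ v y‖ ≤ 1 / 2)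
    (hyl : 0 < y (lastIdx d hd)) :
    hodTr (lastIdx d hd) (fderiv ℝ v y) (fderiv ℝ (fderiv ℝ v) y) = 0 := by
  have hC : ContDiffAt ℝ 2 v y := (hv.contDiffAt hy).of_le (by norm_num)
  have h1 := (fderiv ℝ v y).le_opNorm (stdE (lastIdx d hd))
  rw [PiLp.norm_single, norm_one, mul_one, Real.norm_eq_abs] at h1
  have h2 := (abs_le.1 (h1.trans hg)).1
  rw [hodTr_eq hd _ (by linarith)]
  have h3 := hv.2.1 y hy hyl
  simp only [hodOp, hessC, fderiv_fderiv_apply hC, gradC] at h3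
  rw [h3, mul_zero]

theorem IsHodSol.fderiv_eq (hv : IsHodSol d hd v U) (hy : y ∈ U) (hyl : y (lastIdx d hd) = 0) :
    fderiv ℝ v y (stdE (lastIdx d hd)) =
      √(1 + ∑ i ∈ Finset.univ.erase (lastIdx d hd), fderiv ℝ v y (stdE i) ^ 2) - 1 := by
  have h := hv.2.2 y hy hyl
  rwa [hodN, tangSq_eq] at h

theorem IsHodSol.obliq_eq_zero (hv : IsHodSol d hd v U) (hy : y ∈ U) (hyl : y (lastIdx d hd) = 0) :
    obliq (lastIdx d hd) v y = 0 := by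
  rw [obliq, hv.fderiv_eq hy hyl, tangLen, tangFn]
  simp only [← pow_two]
  ring

theorem IsHodSol.isHodMin (hv : IsHodSol d hd v U) (hy : y ∈ U) (hg : ‖fderiv ℝ v y‖ ≤ 1 / 2) :
    IsHodMin (lastIdx d hd) v y := by
  refine ⟨(hv.contDiffAt hy).of_le (by norm_num),
    fun h => ⟨_, hg, (hv.hodTr_eq_zero hy hg h).le⟩, fun h => ?_⟩
  rw [hv.fderiv_eq hy h]
  have h0 : 0 ≤ ∑ i ∈ Finset.univ.erase (lastIdx d hd), fderiv ℝ v y (stdE i) ^ 2 :=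
    Finset.sum_nonneg fun _ _ => sq_nonneg _
  have := Real.sqrt_one_add_le (x := ∑ i ∈ Finset.univ.erase (lastIdx d hd), fderiv ℝ v y (stdE i) ^ 2)
    (by linarith)
  linarith

theorem IsHodSol.isHodMin_neg (hv : IsHodSol d hd v U) (hy : y ∈ U) (hg : ‖fderiv ℝ v y‖ ≤ 1 / 2) :
    IsHodMin (lastIdx d hd) (fun x => -v x) y := by
  have hD : fderiv ℝ (fun x => -v x) = fun x => -fderiv ℝ v x := funext fun x => fderiv_fun_neg
  refine ⟨((hv.contDiffAt hy).of_le (by norm_num)).neg, fun h => ⟨_, hg, ?_⟩, fun h => ?_⟩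
  · have h1 := hv.hodTr_eq_zero hy hg h
    rw [hD, fderiv_fun_neg]
    simp only [hodTr, neg_apply, Finset.sum_neg_distrib] at h1 ⊢
    rw [h1, neg_zero]
  · have h1 := hv.fderiv_eq hy h
    have h0 : 0 ≤ ∑ i ∈ Finset.univ.erase (lastIdx d hd), fderiv ℝ v y (stdE i) ^ 2 :=
      Finset.sum_nonneg fun _ _ => sq_nonneg _
    have h2 := Real.one_le_sqrt.2 (le_add_of_nonneg_right h0)
    simp only [hD, neg_apply, neg_sq]
    linarith

end Solution

/-- Bounded exterior solutions have a limit at infinity and take values between the extrema on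
`∂B₁⁺` and the limit. -/
theorem stmt5 (d : ℕ) (hd : 2 ≤ d) (v : EuclideanSpace ℝ (Fin d) → ℝ)
    (hsol : IsHodSol d (by omega) v (extDom d (by omega)))
    (hgrad : ∀ y ∈ extDom d (by omega), ‖fderiv ℝ v y‖ ≤ 1 / 2)
    (hbdd : ∃ M : ℝ, ∀ y ∈ extDom d (by omega), |v y| ≤ M) :
    ∃ L : ℝ, Filter.Tendsto v (farFilter d (by omega)) (nhds L) ∧
      ∀ y ∈ extDom d (by omega),
        min (sInf (v '' upSphere d (by omega) 1)) L ≤ v y ∧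
        v y ≤ max (sSup (v '' upSphere d (by omega) 1)) L := by
  have hd0 : 0 < d := by omega
  obtain ⟨M, hM⟩ := hbdd
  have hM' : ∀ x, 0 ≤ x (lastIdx d hd0) → 1 ≤ ‖x‖ → |v x| ≤ |M| + 1 := fun x h1 h2 =>
    (hM x ⟨h1, h2⟩).trans (by linarith [le_abs_self M])
  have hmin : ∀ x, 0 ≤ x (lastIdx d hd0) → 1 ≤ ‖x‖ → IsHodMin (lastIdx d hd0) v x := fun x h1 h2 =>
    hsol.isHodMin ⟨h1, h2⟩ (hgrad x ⟨h1, h2⟩)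
  obtain ⟨L, hL⟩ := exists_tendsto_far (C := 40000 * d * (|M| + 1)) (by positivity) hM' hmin
    fun x h1 h2 => norm_fderiv_mul_norm_le (by positivity)
      (fun y h1 h2 => hsol.contDiffAt ⟨h1, h2⟩)
      (fun y h1 h2 => hgrad y ⟨h1, h2⟩) hM'
      (fun y h1 h2 => hsol.hodTr_eq_zero ⟨h1.le, h2⟩ (hgrad y ⟨h1.le, h2⟩) h1)
      (fun y h1 h2 => hsol.obliq_eq_zero ⟨h1.ge, h2⟩ h1) h1 h2
  refine ⟨L, hL, fun y hy => ⟨le_of_tendsto_far hmin hL (min_le_right _ _) (fun x h1 h2 => ?_) hy.1 hy.2,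
    neg_le_neg_iff.1 <| le_of_tendsto_far (v := fun x => -v x)
      (fun x h1 h2 => hsol.isHodMin_neg ⟨h1, h2⟩ (hgrad x ⟨h1, h2⟩)) hL.neg
      (neg_le_neg (le_max_right _ _)) (fun x h1 h2 => neg_le_neg ?_) hy.1 hy.2⟩⟩
  · refine (min_le_left _ _).trans (csInf_le ⟨-M, ?_⟩ (mem_image_of_mem v (show x ∈ upSphere d hd0 1 from ⟨h1, h2⟩)))
    rintro _ ⟨z, hz, rfl⟩
    exact (abs_le.1 (hM z ⟨hz.1, hz.2.ge⟩)).1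
  · refine (le_csSup ⟨M, ?_⟩ (mem_image_of_mem v (show x ∈ upSphere d hd0 1 from ⟨h1, h2⟩))).trans (le_max_left _ _)
    rintro _ ⟨z, hz, rfl⟩
    exact (abs_le.1 (hM z ⟨hz.1, hz.2.ge⟩)).2
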